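/- arXiv:2010.05368 — 5 statements merged into one kernel-verified Lean document; each statement's English description precedes it below -/
import Mathlib

section
/- Let Y ⊆ ℝ^p be nonempty and compact, X ⊆ ℝ^d, and let S : X ⇉ Y be a set-valued map with nonempty convex compact values, all of the same affine dimension k, which is continuous at x̄ ∈ X. Let ρ : X × Y → [0,∞) be continuous with 0 < ∫_{S(x)} ρ(x,y) dλ_k(y) < ∞ for all x, and define the conditional belief β_x(A) = (∫_{A∩S(x)} ρ(x,y) dλ_k(y))/(∫_{S(x)} ρ(x,y) dλ_k(y)) for Borel A ⊆ Y. Then β is weak continuous at x̄: for every sequence x_n → x̄ in X, β_{x_n} converges weakly to β_{x̄}; equivalently, for every closed set C ⊆ Y, limsup_n β_{x_n}(C) ≤ β_{x̄}(C). -/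
open MeasureTheory Filter Topology Set Pointwise
open scoped ENNReal

/-- The affine dimension of a set: the dimension of its affine hull. -/
noncomputable def adim {p : ℕ} (A : Set (EuclideanSpace ℝ (Fin p))) : ℕ :=
  Module.finrank ℝ (affineSpan ℝ A).direction

/-- Continuity of a set-valued map at a point (Hausdorff-distance style). -/
def SVContinuousAt {d p : ℕ} (X : Set (EuclideanSpace ℝ (Fin d)))
    (S : EuclideanSpace ℝ (Fin d) → Set (EuclideanSpace ℝ (Fin p)))
    (xb : EuclideanSpace ℝ (Fin d)) : Prop :=
  ∀ ε > (0 : ℝ), ∃ δ > (0 : ℝ), ∀ x ∈ X, ‖x - xb‖ < δ →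
    S x ⊆ S xb + Metric.closedBall 0 ε ∧ S xb ⊆ S x + Metric.closedBall 0 ε

/-- The conditional belief with density `ρ` w.r.t. the `k`-dimensional Hausdorff
measure: `β_x(A) = (∫_{A∩S(x)} ρ(x,y) dλ_k(y)) / (∫_{S(x)} ρ(x,y) dλ_k(y))`. -/
noncomputable def condBeliefK {d p : ℕ} (k : ℕ)
    (S : EuclideanSpace ℝ (Fin d) → Set (EuclideanSpace ℝ (Fin p)))
    (ρ : EuclideanSpace ℝ (Fin d) → EuclideanSpace ℝ (Fin p) → ℝ)
    (x : EuclideanSpace ℝ (Fin d)) : Measure (EuclideanSpace ℝ (Fin p)) :=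
  (∫⁻ y in S x, ENNReal.ofReal (ρ x y) ∂(μH[(k : ℝ)]))⁻¹ •
    ((μH[(k : ℝ)] : Measure (EuclideanSpace ℝ (Fin p))).restrict (S x)).withDensity
      fun y => ENNReal.ofReal (ρ x y)

open scoped NNReal

theorem exists_hausdorffMeasure_restrict_eq_smul_map {E : Type*} [NormedAddCommGroup E]
    [NormedSpace ℝ E] [MeasurableSpace E] [BorelSpace E] {k : ℕ}
    (L : (Fin k → ℝ) →L[ℝ] E) (hL : Function.Injective L) (v : E) :
    ∃ c : ℝ≥0, ∀ s : Set E, MeasurableSet s → s ⊆ range (fun t => v + L t) →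
      (μH[(k : ℝ)] : Measure E).restrict s =
        c • (volume.restrict ((fun t => v + L t) ⁻¹' s)).map (fun t => v + L t) := by
  have hemb : MeasurableEmbedding (fun t => v + L t) :=
    ((Homeomorph.addLeft v).isClosedEmbedding.comp
      (LinearMap.isClosedEmbedding_of_injective (f := L.toLinearMap)
        (LinearMap.ker_eq_bot.2 hL))).measurableEmbedding
  have hvol : (μH[(k : ℝ)] : Measure (Fin k → ℝ)) = volume := by
    simpa using hausdorffMeasure_pi_real (ι := Fin k)
  have hlip : LipschitzWith ‖L‖₊ (fun t => v + L t) := by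
    simpa using (LipschitzWith.const v).add L.lipschitz
  set m : Measure (Fin k → ℝ) := (μH[(k : ℝ)] : Measure E).comap (fun t => v + L t) with hm
  have : m.IsAddLeftInvariant := by
    refine ⟨fun g => ?_⟩
    ext s hs
    rw [Measure.map_apply (measurable_const_add g) hs, hm, hemb.comap_apply, hemb.comap_apply]
    have : (fun t => v + L t) '' s =
        (fun y => L g + y) '' ((fun t => v + L t) '' ((fun x => g + x) ⁻¹' s)) := by
      ext y
      simp only [mem_image, mem_preimage, exists_exists_and_eq_and]
      constructor
      · rintro ⟨t, ht, rfl⟩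
        exact ⟨t - g, by simpa using ht, by simp; abel⟩
      · rintro ⟨t, ht, rfl⟩
        exact ⟨g + t, ht, by simp; abel⟩
    rw [this, image_add_left, measure_preimage_add]
  have : IsFiniteMeasureOnCompacts m := by
    refine ⟨fun K hK => ?_⟩
    rw [hm, hemb.comap_apply]
    refine (hlip.hausdorffMeasure_image_le (Nat.cast_nonneg k) K).trans_lt ?_
    rw [hvol]
    exact ENNReal.mul_lt_top (by simp) hK.measure_lt_top
  refine ⟨Measure.addHaarScalarFactor m volume, fun s hs hsub => ?_⟩
  rw [← Measure.map_smul, ← Measure.restrict_smul, ← Measure.isAddLeftInvariant_eq_smul m volume,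
    ← hemb.restrict_map, hm, hemb.map_comap, Measure.restrict_restrict hs,
    inter_eq_left.2 hsub]

theorem exists_eventually_mul_norm_le {ι F E : Type*} [NormedAddCommGroup F] [NormedSpace ℝ F]
    [FiniteDimensional ℝ F] [NormedAddCommGroup E] [NormedSpace ℝ E] {l : Filter ι}
    {L : F →L[ℝ] E} {Ln : ι → F →L[ℝ] E} (hL : Function.Injective L)
    (hLn : Tendsto Ln l (𝓝 L)) : ∃ c > 0, ∀ᶠ n in l, ∀ t, c * ‖t‖ ≤ ‖Ln n t‖ := by
  obtain ⟨K, hK, hanti⟩ := L.toLinearMap.exists_antilipschitzWith (LinearMap.ker_eq_bot.2 hL)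
  have hK' : (0 : ℝ) < K := hK
  have hbelow : ∀ t, (K : ℝ)⁻¹ * ‖t‖ ≤ ‖L t‖ := fun t => by
    rw [inv_mul_le_iff₀ hK']
    simpa [dist_eq_norm] using hanti.le_mul_dist t 0
  refine ⟨(K : ℝ)⁻¹ / 2, by positivity, ?_⟩
  filter_upwards [Metric.tendsto_nhds.1 hLn ((K : ℝ)⁻¹ / 2) (by positivity)] with n hn t
  rw [dist_eq_norm] at hn
  have h1 : ‖(Ln n - L) t‖ ≤ (K : ℝ)⁻¹ / 2 * ‖t‖ := (Ln n - L).le_of_opNorm_le hn.le t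
  have h2 : ‖L t‖ ≤ ‖Ln n t‖ + ‖(Ln n - L) t‖ := by
    simpa using norm_sub_le (Ln n t) ((Ln n - L) t)
  linarith [hbelow t]

theorem Convex.mem_of_forall_closedBall_exists {F : Type*} [NormedAddCommGroup F]
    [NormedSpace ℝ F] {K : Set F} (hK : Convex ℝ K) (hKc : IsClosed K) {t : F} {r : ℝ}
    (hr : 0 < r) (h : ∀ s ∈ Metric.closedBall t r, ∃ u ∈ K, ‖s - u‖ ≤ r / 4) : t ∈ K := by
  by_contra ht
  obtain ⟨f, w, hfK, hft⟩ := geometric_hahn_banach_closed_point hK hKc ht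
  have hf : 0 < ‖f‖ := by
    obtain ⟨u, hu, -⟩ := h t (Metric.mem_closedBall_self hr.le)
    refine norm_pos_iff.2 ?_
    rintro rfl
    have := hfK u hu
    simp only [zero_apply] at this hft
    linarith
  obtain ⟨e, he, hfe⟩ : ∃ e, ‖e‖ < 1 ∧ ‖f‖ / 2 < f e := by
    obtain ⟨e, he, hfe⟩ := f.exists_lt_apply_of_lt_opNorm (half_lt_self hf)
    rcases le_total 0 (f e) with h0 | h0
    · exact ⟨e, he, by rwa [Real.norm_of_nonneg h0] at hfe⟩
    · exact ⟨-e, by simpa using he, by rwa [Real.norm_of_nonpos h0, ← map_neg] at hfe⟩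
  obtain ⟨u, hu, hsu⟩ := h (t + r • e) (by
    simp only [Metric.mem_closedBall, dist_self_add_left, norm_smul, Real.norm_of_nonneg hr.le]
    nlinarith)
  have h1 : f (t + r • e - u) ≤ ‖f‖ * (r / 4) :=
    (le_abs_self _).trans ((f.le_opNorm _).trans (by gcongr))
  have h2 := hfK u hu
  simp only [map_sub, map_add, map_smul, smul_eq_mul] at h1
  nlinarith

theorem tendsto_setIntegral_affine_preimage {P E : Type*} [TopologicalSpace P]
    [NormedAddCommGroup E] [NormedSpace ℝ E] {k : ℕ}
    {L : (Fin k → ℝ) →L[ℝ] E} {Ln : ℕ → (Fin k → ℝ) →L[ℝ] E} (hL : Function.Injective L)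
    (hLn : Tendsto Ln atTop (𝓝 L)) {v : E} {vn : ℕ → E} (hvn : Tendsto vn atTop (𝓝 v))
    {Y S : Set E} {Sn : ℕ → Set E} (hY : IsCompact Y) (hSc : IsClosed S) (hS : Convex ℝ S)
    (hSnc : ∀ n, IsClosed (Sn n)) (hSn : ∀ n, Convex ℝ (Sn n)) (hSnY : ∀ n, Sn n ⊆ Y)
    (hrange : ∀ᶠ n in atTop, Sn n ⊆ range fun t => vn n + Ln n t)
    (hupper : ∀ ε > 0, ∀ᶠ n in atTop, ∀ z ∈ Sn n, ∃ y ∈ S, ‖z - y‖ ≤ ε)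
    (hlower : ∀ ε > 0, ∀ᶠ n in atTop, ∀ y ∈ S, ∃ z ∈ Sn n, ‖y - z‖ ≤ ε)
    {x : P} {xn : ℕ → P} (hxn : Tendsto xn atTop (𝓝 x))
    {G : P × E → ℝ} (hG : Continuous G) :
    Tendsto (fun n => ∫ t in (fun t => vn n + Ln n t) ⁻¹' Sn n, G (xn n, vn n + Ln n t)) atTop
      (𝓝 (∫ t in (fun t => v + L t) ⁻¹' S, G (x, v + L t))) := by
  obtain ⟨c, hc, hcn⟩ := exists_eventually_mul_norm_le hL hLn
  have hA : ∀ t, Tendsto (fun n => vn n + Ln n t) atTop (𝓝 (v + L t)) := fun t =>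
    hvn.add ((ContinuousLinearMap.apply ℝ E t).continuous.continuousAt.tendsto.comp hLn)
  have hTc : IsClosed ((fun t => v + L t) ⁻¹' S) := hSc.preimage (by fun_prop)
  have hTnc : ∀ n, IsClosed ((fun t => vn n + Ln n t) ⁻¹' Sn n) := fun n =>
    (hSnc n).preimage (by fun_prop)
  have hpre : ∀ {K : Set E} (hK : Convex ℝ K) (w : E) (M : (Fin k → ℝ) →L[ℝ] E),
      Convex ℝ ((fun t => w + M t) ⁻¹' K) := fun hK w M =>
    (hK.translate_preimage_right w).is_linear_preimage M.toLinearMap.isLinear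
  obtain ⟨R, hR⟩ := hY.isBounded.exists_norm_le
  obtain ⟨B, hB⟩ := (hxn.isCompact_insert_range.prod hY).exists_bound_of_continuousOn
    hG.continuousOn
  have hB0 : ∀ n t, (fun t => vn n + Ln n t) t ∈ Sn n → ‖G (xn n, vn n + Ln n t)‖ ≤ B :=
    fun n t ht => hB _ ⟨mem_insert_of_mem _ (mem_range_self n), hSnY n ht⟩
  have hvb : ∀ᶠ n in atTop, ‖vn n‖ ≤ ‖v‖ + 1 :=
    (hvn.norm.eventually (gt_mem_nhds (lt_add_one ‖v‖))).mono fun _ h => h.le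
  rw [← integral_indicator hTc.measurableSet]
  refine Tendsto.congr (fun n => integral_indicator (hTnc n).measurableSet) ?_
  set ρ := (R + (‖v‖ + 1)) / c
  refine tendsto_integral_filter_of_dominated_convergence (l := atTop)
    ((Metric.closedBall 0 ρ).indicator fun _ => |B|) ?_ ?_ ?_ ?_
  · exact .of_forall fun n => ((by fun_prop : Continuous fun t => G (xn n, vn n + Ln n t))
      |>.aestronglyMeasurable).indicator (hTnc n).measurableSet
  · filter_upwards [hcn, hvb] with n hn hvn
    refine .of_forall fun t => ?_
    by_cases ht : t ∈ (fun t => vn n + Ln n t) ⁻¹' Sn n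
    · have h1 : ‖vn n + Ln n t‖ ≤ R := hR _ (hSnY n ht)
      have h2 : ‖Ln n t‖ ≤ ‖vn n + Ln n t‖ + ‖vn n‖ := by
        simpa using norm_sub_le (vn n + Ln n t) (vn n)
      have h3 : t ∈ Metric.closedBall (0 : Fin k → ℝ) ρ := by
        rw [mem_closedBall_zero_iff, le_div_iff₀ hc]
        linarith [hn t]
      rw [indicator_of_mem ht, indicator_of_mem h3]
      exact (hB0 n t ht).trans (le_abs_self B)
    · rw [indicator_of_notMem ht, norm_zero]
      exact indicator_nonneg (fun _ _ => abs_nonneg B) t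
  · exact (integrable_indicator_iff Metric.isClosed_closedBall.measurableSet).2
      (integrableOn_const (isCompact_closedBall _ _).measure_lt_top.ne)
  · have hfr : ∀ᵐ t : Fin k → ℝ, t ∉ frontier ((fun t => v + L t) ⁻¹' S) :=
      measure_eq_zero_iff_ae_notMem.1 ((hpre hS v L).addHaar_frontier _)
    filter_upwards [hfr] with t ht
    by_cases hmem : t ∈ (fun t => v + L t) ⁻¹' S
    · have hint : t ∈ interior ((fun t => v + L t) ⁻¹' S) := by
        by_contra h
        exact ht ⟨subset_closure hmem, h⟩
      obtain ⟨r, hr, hball⟩ := Metric.nhds_basis_closedBall.mem_iff.1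
        (mem_interior_iff_mem_nhds.1 hint)
      have hmemn : ∀ᶠ n in atTop, t ∈ (fun t => vn n + Ln n t) ⁻¹' Sn n := by
        have hM : 0 < ‖t‖ + r + 1 := by positivity
        have hη : 0 < c * (r / 4) / 3 := by positivity
        filter_upwards [hcn, hrange, hlower _ hη, Metric.tendsto_nhds.1 hvn _ hη,
          Metric.tendsto_nhds.1 hLn (c * (r / 4) / 3 / (‖t‖ + r + 1)) (by positivity)] with
          n hn hrn hln hvn' hLn'
        rw [dist_eq_norm] at hvn' hLn'
        refine (hpre (hSn n) _ _).mem_of_forall_closedBall_exists (hTnc n) hr fun s hs => ?_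
        obtain ⟨z, hz, hsz⟩ := hln _ (hball hs)
        obtain ⟨u, rfl⟩ := hrn hz
        refine ⟨u, hz, ?_⟩
        have hs' : ‖s‖ ≤ ‖t‖ + r + 1 := by
          rw [mem_closedBall_iff_norm] at hs
          have := norm_add_le (s - t) t
          rw [sub_add_cancel] at this
          linarith
        have h1 : ‖(Ln n - L) s‖ ≤ c * (r / 4) / 3 :=
          ((Ln n - L).le_opNorm_of_le hs').trans ((le_div_iff₀ hM).1 hLn'.le)
        have h2 : Ln n (s - u) = ((v + L s) - (vn n + Ln n u)) + (vn n - v) + (Ln n - L) s := by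
          simp only [map_sub, sub_apply]
          abel
        have h3 : ‖Ln n (s - u)‖ ≤ c * (r / 4) := by
          rw [h2]
          refine (norm_add₃_le).trans ?_
          simp only at hsz
          linarith
        exact le_of_mul_le_mul_left ((hn _).trans h3) hc
      rw [indicator_of_mem hmem]
      refine Tendsto.congr' (hmemn.mono fun n hn => (indicator_of_mem hn _).symm) ?_
      exact (hG.tendsto _).comp (hxn.prodMk_nhds (hA t))
    · rw [indicator_of_notMem hmem]
      refine tendsto_const_nhds.congr' ?_
      obtain ⟨r, hr, hball⟩ := Metric.nhds_basis_closedBall.mem_iff.1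
        (hSc.isOpen_compl.mem_nhds hmem)
      filter_upwards [hupper (r / 2) (by positivity),
        Metric.tendsto_nhds.1 (hA t) (r / 2) (by positivity)] with n hu hd
      refine (indicator_of_notMem (fun hn => ?_) _).symm
      obtain ⟨y, hy, hzy⟩ := hu _ hn
      refine hball (a := y) ?_ hy
      rw [Metric.mem_closedBall]
      have := dist_triangle_left y (v + L t) (vn n + Ln n t)
      rw [dist_eq_norm (vn n + Ln n t) y] at this
      simp only at hzy
      linarith

theorem exists_linearIndependent_add_mem {E : Type*} [AddCommGroup E] [Module ℝ E]
    [FiniteDimensional ℝ E] {k : ℕ}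
    {S : Set E} (hk : Module.finrank ℝ (vectorSpan ℝ S) = k) {v : E} (hv : v ∈ S) :
    ∃ w : Fin k → E, LinearIndependent ℝ w ∧ ∀ i, v + w i ∈ S := by
  rw [vectorSpan_eq_span_vsub_set_right ℝ hv] at hk
  obtain ⟨w, hw, -, hli⟩ := Submodule.exists_fun_fin_finrank_span_eq ℝ ((· -ᵥ v) '' S)
  subst hk
  refine ⟨w, hli, fun i => ?_⟩
  obtain ⟨y, hy, hyw⟩ := hw i
  rw [← hyw]
  simpa using hy

/-- The continuous linear map sending the standard basis of `Fin k → ℝ` to the family `w`. -/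
noncomputable def frameMap {E : Type*} [NormedAddCommGroup E] [NormedSpace ℝ E] {k : ℕ}
    (w : Fin k → E) : (Fin k → ℝ) →L[ℝ] E :=
  ∑ i, (ContinuousLinearMap.proj i : (Fin k → ℝ) →L[ℝ] ℝ).smulRight (w i)

theorem frameMap_toLinearMap {E : Type*} [NormedAddCommGroup E] [NormedSpace ℝ E] {k : ℕ}
    (w : Fin k → E) : (frameMap w).toLinearMap = Fintype.linearCombination ℝ w := by
  refine LinearMap.ext fun t => ?_
  simp [frameMap, Fintype.linearCombination_apply]

theorem frameMap_injective {E : Type*} [NormedAddCommGroup E] [NormedSpace ℝ E] {k : ℕ}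
    {w : Fin k → E} (hw : LinearIndependent ℝ w) : Function.Injective (frameMap w) := by
  have := hw.fintypeLinearCombination_injective
  rwa [← frameMap_toLinearMap] at this

theorem tendsto_frameMap {ι E : Type*} [NormedAddCommGroup E] [NormedSpace ℝ E] {k : ℕ}
    {l : Filter ι} {w : Fin k → E} {wn : ι → Fin k → E}
    (h : ∀ i, Tendsto (fun n => wn n i) l (𝓝 (w i))) :
    Tendsto (fun n => frameMap (wn n)) l (𝓝 (frameMap w)) :=
  tendsto_finsetSum _ fun i _ =>
    (ContinuousLinearMap.smulRightL ℝ (Fin k → ℝ) E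
      (ContinuousLinearMap.proj i)).continuous.continuousAt.tendsto.comp (h i)

theorem subset_range_frameMap {E : Type*} [NormedAddCommGroup E] [NormedSpace ℝ E]
    [FiniteDimensional ℝ E] {k : ℕ} {S : Set E} (hk : Module.finrank ℝ (vectorSpan ℝ S) = k)
    {v : E} (hv : v ∈ S) {w : Fin k → E} (hw : ∀ i, v + w i ∈ S)
    (hinj : Function.Injective (frameMap w)) : S ⊆ range fun t => v + frameMap w t := by
  have hrange : (frameMap w).toLinearMap.range = vectorSpan ℝ S := by
    refine Submodule.eq_of_le_of_finrank_eq ?_ ?_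
    · rw [frameMap_toLinearMap, Fintype.range_linearCombination, Submodule.span_le]
      rintro _ ⟨i, rfl⟩
      simpa using vsub_mem_vectorSpan ℝ (hw i) hv
    · rw [hk, LinearMap.finrank_range_of_inj hinj, Module.finrank_fin_fun]
  intro z hz
  obtain ⟨t, ht⟩ : z - v ∈ (frameMap w).toLinearMap.range :=
    hrange ▸ vsub_mem_vectorSpan ℝ hz hv
  exact ⟨t, by simpa [eq_sub_iff_add_eq'] using ht⟩

theorem exists_seq_mem_tendsto {E : Type*} [NormedAddCommGroup E] {S : Set E} {Sn : ℕ → Set E}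
    (hne : ∀ n, (Sn n).Nonempty) (hcomp : ∀ n, IsCompact (Sn n))
    (hlower : ∀ ε > 0, ∀ᶠ n in atTop, ∀ y ∈ S, ∃ z ∈ Sn n, ‖y - z‖ ≤ ε) {y : E} (hy : y ∈ S) :
    ∃ z : ℕ → E, (∀ n, z n ∈ Sn n) ∧ Tendsto z atTop (𝓝 y) := by
  choose z hz hzd using fun n => (hcomp n).exists_infDist_eq_dist (hne n) y
  refine ⟨z, hz, Metric.tendsto_nhds.2 fun ε hε => ?_⟩
  filter_upwards [hlower (ε / 2) (half_pos hε)] with n hn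
  obtain ⟨u, hu, hyu⟩ := hn y hy
  rw [dist_comm, ← hzd n]
  exact (Metric.infDist_le_dist_of_mem hu).trans_lt (by rw [dist_eq_norm]; linarith)

theorem integral_condBeliefK {d p k : ℕ}
    {S : EuclideanSpace ℝ (Fin d) → Set (EuclideanSpace ℝ (Fin p))}
    {ρ : EuclideanSpace ℝ (Fin d) → EuclideanSpace ℝ (Fin p) → ℝ} {x : EuclideanSpace ℝ (Fin d)}
    (hS : MeasurableSet (S x)) (hρnn : ∀ y, 0 ≤ ρ x y) (hρ : Continuous (ρ x))
    (hmass : 0 < ∫⁻ y in S x, ENNReal.ofReal (ρ x y) ∂(μH[(k : ℝ)]))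
    {L : (Fin k → ℝ) →L[ℝ] EuclideanSpace ℝ (Fin p)} (hL : Function.Injective L)
    {v : EuclideanSpace ℝ (Fin p)} (hrange : S x ⊆ range fun t => v + L t)
    {f : EuclideanSpace ℝ (Fin p) → ℝ} (hf : Continuous f) :
    ∫ y, f y ∂(condBeliefK k S ρ x) =
      (∫ t in (fun t => v + L t) ⁻¹' S x, ρ x (v + L t) * f (v + L t)) /
        ∫ t in (fun t => v + L t) ⁻¹' S x, ρ x (v + L t) := by
  obtain ⟨c, hc⟩ := exists_hausdorffMeasure_restrict_eq_smul_map L hL v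
  have hν := hc _ hS hrange
  have hc0 : (c : ℝ) ≠ 0 := by
    rintro h
    rw [hν, NNReal.coe_eq_zero.1 h] at hmass
    simp at hmass
  have key : ∀ g : EuclideanSpace ℝ (Fin p) → ℝ, Continuous g →
      ∫ y in S x, g y ∂(μH[(k : ℝ)]) =
        c * ∫ t in (fun t => v + L t) ⁻¹' S x, g (v + L t) := fun g hg => by
    rw [hν, integral_smul_nnreal_measure, integral_map (by fun_prop) hg.aestronglyMeasurable]
    rfl
  have hmassR : (∫⁻ y in S x, ENNReal.ofReal (ρ x y) ∂(μH[(k : ℝ)])).toReal =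
      ∫ y in S x, ρ x y ∂(μH[(k : ℝ)]) :=
    (integral_eq_lintegral_of_nonneg_ae (.of_forall hρnn) hρ.aestronglyMeasurable).symm
  rw [condBeliefK, integral_smul_measure, ENNReal.toReal_inv, hmassR,
    integral_withDensity_eq_integral_toReal_smul (by fun_prop)
      (.of_forall fun _ => ENNReal.ofReal_lt_top)]
  simp only [ENNReal.toReal_ofReal (hρnn _), smul_eq_mul]
  rw [key _ hρ, key (fun y => ρ x y * f y) (hρ.mul hf), ← div_eq_inv_mul, mul_div_mul_left _ _ hc0]

theorem isProbabilityMeasure_condBeliefK {d p k : ℕ}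
    {S : EuclideanSpace ℝ (Fin d) → Set (EuclideanSpace ℝ (Fin p))}
    {ρ : EuclideanSpace ℝ (Fin d) → EuclideanSpace ℝ (Fin p) → ℝ} {x : EuclideanSpace ℝ (Fin d)}
    (hpos : 0 < ∫⁻ y in S x, ENNReal.ofReal (ρ x y) ∂(μH[(k : ℝ)]))
    (hfin : ∫⁻ y in S x, ENNReal.ofReal (ρ x y) ∂(μH[(k : ℝ)]) < ⊤) :
    IsProbabilityMeasure (condBeliefK k S ρ x) := by
  refine ⟨?_⟩
  rw [condBeliefK, Measure.smul_apply, withDensity_apply _ MeasurableSet.univ,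
    Measure.restrict_univ, smul_eq_mul, ENNReal.inv_mul_cancel hpos.ne' hfin.ne]

/-- for a set-valued map with nonempty convex compact values of constant
affine dimension `k`, continuous at `xb`, any conditional belief with continuous
density is weak continuous at `xb`; equivalently, for every closed `C ⊆ Y`,
`limsup_n β_{x_n}(C) ≤ β_{xb}(C)` along sequences `x_n → xb` in `X`. -/
theorem stmt_11 {d p : ℕ}
    (X : Set (EuclideanSpace ℝ (Fin d))) (Y : Set (EuclideanSpace ℝ (Fin p)))
    (hYne : Y.Nonempty) (hYcomp : IsCompact Y)
    (S : EuclideanSpace ℝ (Fin d) → Set (EuclideanSpace ℝ (Fin p)))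
    (hSY : ∀ x ∈ X, S x ⊆ Y)
    (hSne : ∀ x ∈ X, (S x).Nonempty)
    (hSconv : ∀ x ∈ X, Convex ℝ (S x))
    (hScomp : ∀ x ∈ X, IsCompact (S x))
    (k : ℕ) (hSdim : ∀ x ∈ X, adim (S x) = k)
    (xb : EuclideanSpace ℝ (Fin d)) (hxb : xb ∈ X)
    (hScont : SVContinuousAt X S xb)
    (ρ : EuclideanSpace ℝ (Fin d) → EuclideanSpace ℝ (Fin p) → ℝ)
    (hρnn : ∀ x y, 0 ≤ ρ x y)
    (hρcont : Continuous (fun q : EuclideanSpace ℝ (Fin d) × EuclideanSpace ℝ (Fin p) =>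
      ρ q.1 q.2))
    (hρmass : ∀ x ∈ X, 0 < (∫⁻ y in S x, ENNReal.ofReal (ρ x y) ∂(μH[(k : ℝ)])) ∧
      (∫⁻ y in S x, ENNReal.ofReal (ρ x y) ∂(μH[(k : ℝ)])) < ⊤) :
    ∀ (xseq : ℕ → EuclideanSpace ℝ (Fin d)),
      (∀ n, xseq n ∈ X) → Tendsto xseq atTop (𝓝 xb) →
      -- weak convergence of the beliefs ...
      ((∀ f : EuclideanSpace ℝ (Fin p) → ℝ, Continuous f → (∃ C, ∀ y, |f y| ≤ C) →
        Tendsto (fun n => ∫ y, f y ∂(condBeliefK k S ρ (xseq n))) atTop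
          (𝓝 (∫ y, f y ∂(condBeliefK k S ρ xb)))) ∧
      -- ... equivalently, the limsup inequality on closed sets
      (∀ C : Set (EuclideanSpace ℝ (Fin p)), C ⊆ Y → IsClosed C →
        Filter.limsup (fun n => condBeliefK k S ρ (xseq n) C) atTop ≤
          condBeliefK k S ρ xb C)) := by
  intro xseq hxX hx
  have hev : ∀ ε > 0, ∀ᶠ n in atTop, S (xseq n) ⊆ S xb + Metric.closedBall 0 ε ∧
      S xb ⊆ S (xseq n) + Metric.closedBall 0 ε := fun ε hε => by
    obtain ⟨δ, hδ, h⟩ := hScont ε hε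
    filter_upwards [Metric.tendsto_nhds.1 hx δ hδ] with n hn
    exact h _ (hxX n) (by rwa [← dist_eq_norm])
  have hmem : ∀ {A B : Set (EuclideanSpace ℝ (Fin p))} {ε : ℝ},
      A ⊆ B + Metric.closedBall 0 ε → ∀ z ∈ A, ∃ y ∈ B, ‖z - y‖ ≤ ε := fun h z hz => by
    obtain ⟨y, hy, e, he, rfl⟩ := h hz
    exact ⟨y, hy, by simpa using he⟩
  have hupper : ∀ ε > 0, ∀ᶠ n in atTop, ∀ z ∈ S (xseq n), ∃ y ∈ S xb, ‖z - y‖ ≤ ε :=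
    fun ε hε => (hev ε hε).mono fun _ h => hmem h.1
  have hlower : ∀ ε > 0, ∀ᶠ n in atTop, ∀ y ∈ S xb, ∃ z ∈ S (xseq n), ‖y - z‖ ≤ ε :=
    fun ε hε => (hev ε hε).mono fun _ h => hmem h.2
  have hdim : ∀ x ∈ X, Module.finrank ℝ (vectorSpan ℝ (S x)) = k := fun x hxX => by
    rw [← direction_affineSpan]
    exact hSdim x hxX
  obtain ⟨v, hv⟩ := hSne xb hxb
  obtain ⟨w, hwli, hw⟩ := exists_linearIndependent_add_mem (hdim xb hxb) hv
  have hsel := fun y hy => exists_seq_mem_tendsto (fun n => hSne _ (hxX n))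
    (fun n => hScomp _ (hxX n)) hlower (y := y) hy
  obtain ⟨vn, hvnS, hvn⟩ := hsel v hv
  choose un hunS hun using fun i => hsel _ (hw i)
  set wn : ℕ → Fin k → EuclideanSpace ℝ (Fin p) := fun n i => un i n - vn n
  have hLinj := frameMap_injective hwli
  have hLn : Tendsto (fun n => frameMap (wn n)) atTop (𝓝 (frameMap w)) :=
    tendsto_frameMap fun i => by simpa using (hun i).sub hvn
  have hinj : ∀ᶠ n in atTop, Function.Injective (frameMap (wn n)) := by
    obtain ⟨c, hc, hcn⟩ := exists_eventually_mul_norm_le hLinj hLn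
    filter_upwards [hcn] with n hn
    refine (injective_iff_map_eq_zero _).2 fun t ht => ?_
    have := hn t
    rw [ht, norm_zero] at this
    exact norm_le_zero_iff.1 (nonpos_of_mul_nonpos_right this hc)
  have hrange : ∀ᶠ n in atTop, S (xseq n) ⊆ range fun t => vn n + frameMap (wn n) t :=
    hinj.mono fun n hn => subset_range_frameMap (hdim _ (hxX n)) (hvnS n)
      (fun i => by simpa [wn] using hunS i n) hn
  have hrange0 := subset_range_frameMap (hdim xb hxb) hv hw hLinj
  have hρx : ∀ x, Continuous (ρ x) := fun x => hρcont.comp (by fun_prop : Continuous (Prod.mk x))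
  have hlim : ∀ {G : EuclideanSpace ℝ (Fin d) × EuclideanSpace ℝ (Fin p) → ℝ}, Continuous G → _ :=
    fun {G} => tendsto_setIntegral_affine_preimage (G := G) hLinj hLn hvn hYcomp
      (hScomp xb hxb).isClosed (hSconv xb hxb)
      (fun n => (hScomp _ (hxX n)).isClosed) (fun n => hSconv _ (hxX n))
      (fun n => hSY _ (hxX n)) hrange hupper hlower hx
  have := isProbabilityMeasure_condBeliefK (hρmass xb hxb).1 (hρmass xb hxb).2
  have hprob := fun n => isProbabilityMeasure_condBeliefK (hρmass _ (hxX n)).1 (hρmass _ (hxX n)).2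
  have hweak : ∀ f : EuclideanSpace ℝ (Fin p) → ℝ, Continuous f →
      Tendsto (fun n => ∫ y, f y ∂(condBeliefK k S ρ (xseq n))) atTop
        (𝓝 (∫ y, f y ∂(condBeliefK k S ρ xb))) := fun f hf => by
    have hform := fun {f} (hf : Continuous f) => integral_condBeliefK (k := k)
      (hScomp xb hxb).measurableSet (hρnn xb) (hρx xb) (hρmass xb hxb).1 hLinj hrange0 hf
    have hne : ∫ t in (fun t => v + frameMap w t) ⁻¹' S xb, ρ xb (v + frameMap w t) ≠ 0 := by
      intro h0
      have := hform (f := fun _ => 1) continuous_const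
      rw [h0, div_zero] at this
      simp at this
    rw [hform hf]
    refine ((hlim (hρcont.mul (hf.comp continuous_snd))).div (hlim hρcont) hne).congr' ?_
    filter_upwards [hinj, hrange] with n hin hrn
    exact (integral_condBeliefK (hScomp _ (hxX n)).measurableSet (hρnn _) (hρx _)
      (hρmass _ (hxX n)).1 hin hrn hf).symm
  refine ⟨fun f hf _ => hweak f hf, fun C _ hC => ?_⟩
  exact ProbabilityMeasure.limsup_measure_closed_le_of_tendsto
    (μ := ⟨condBeliefK k S ρ xb, this⟩) (μs := fun n => ⟨condBeliefK k S ρ (xseq n), hprob n⟩)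
    (ProbabilityMeasure.tendsto_iff_forall_integral_tendsto.2 fun f => hweak f f.continuous) hC
end

section
/- Let g : ℝ^p → ℝ be convex and weakly analytic, and let C ⊆ ℝ^p be a convex set on which g is constant. Then g(y + v) = g(y) for every y ∈ ℝ^p and every v in the linear span L = span(C − C) of the difference set of C. -/
open Set Pointwise

/-- A function `g : ℝ^p → ℝ` is weakly analytic if for all `y, u`: whenever
`α ↦ g(y + αu)` is constant on a nonempty open interval, it is globally constant,
equal to `g y`. -/
def WeaklyAnalytic {p : ℕ} (g : EuclideanSpace ℝ (Fin p) → ℝ) : Prop :=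
  ∀ y u : EuclideanSpace ℝ (Fin p),
    (∃ a b : ℝ, a < b ∧ ∃ c : ℝ, ∀ α ∈ Set.Ioo a b, g (y + α • u) = c) →
    ∀ α : ℝ, g (y + α • u) = g y

/-- A convex function that is bounded above on the ray from `y` in direction `u`
does not increase along `u`. -/
theorem ConvexOn.apply_add_le_of_forall_apply_add_smul_le {E : Type*} [AddCommGroup E] [Module ℝ E]
    {g : E → ℝ} (hg : ConvexOn ℝ univ g) {y u : E} {M : ℝ}
    (hM : ∀ s : ℝ, 1 ≤ s → g (y + s • u) ≤ M) : g (y + u) ≤ g y := by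
  have key : ∀ s : ℝ, 1 ≤ s → s * (g (y + u) - g y) ≤ M - g y := by
    intro s hs
    have hs0 : 0 < s := by linarith
    have h := hg.2 (mem_univ y) (mem_univ (y + s • u))
      (sub_nonneg.2 (inv_le_one_of_one_le₀ hs)) (inv_nonneg.2 hs0.le) (sub_add_cancel 1 s⁻¹)
    have e : (1 - s⁻¹) • y + s⁻¹ • (y + s • u) = y + u := by
      rw [smul_add, smul_smul, inv_mul_cancel₀ hs0.ne', sub_smul, one_smul, one_smul]
      abel
    rw [e, smul_eq_mul, smul_eq_mul] at h
    have h' := mul_le_mul_of_nonneg_left h hs0.le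
    have e' : s * ((1 - s⁻¹) * g y + s⁻¹ * g (y + s • u)) = s * g y - g y + g (y + s • u) := by
      field_simp
    linarith [hM s hs]
  by_contra! hlt
  have hd : 0 < g (y + u) - g y := sub_pos.2 hlt
  have h := key (max 1 ((M - g y) / (g (y + u) - g y) + 1)) (le_max_left _ _)
  have h' := mul_le_mul_of_nonneg_right
    (le_max_right 1 ((M - g y) / (g (y + u) - g y) + 1)) hd.le
  rw [add_mul, div_mul_cancel₀ _ hd.ne'] at h'
  linarith

/-- A convex function that is bounded above on one line is invariant under translations in the
direction of that line. -/
theorem ConvexOn.apply_add_smul_eq_of_forall_apply_add_smul_le {E : Type*} [AddCommGroup E]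
    [Module ℝ E] {g : E → ℝ} (hg : ConvexOn ℝ univ g) {x u : E} {c : ℝ}
    (hc : ∀ t : ℝ, g (x + t • u) ≤ c) (t : ℝ) (y : E) : g (y + t • u) = g y := by
  have le : ∀ (t : ℝ) (y : E), g (y + t • u) ≤ g y := by
    intro t y
    refine hg.apply_add_le_of_forall_apply_add_smul_le
      (M := (1 / 2) * g ((2 : ℝ) • y - x) + (1 / 2) * c) fun s _ => ?_
    have h := hg.2 (mem_univ ((2 : ℝ) • y - x)) (mem_univ (x + (2 * s * t) • u))
      (by norm_num : (0 : ℝ) ≤ 1 / 2) (by norm_num : (0 : ℝ) ≤ 1 / 2) (by norm_num)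
    have e : (1 / 2 : ℝ) • ((2 : ℝ) • y - x) + (1 / 2 : ℝ) • (x + (2 * s * t) • u)
        = y + s • t • u := by module
    rw [e, smul_eq_mul, smul_eq_mul] at h
    linarith [hc (2 * s * t)]
  refine le_antisymm (le t y) ?_
  simpa using le (-t) (y + t • u)

/-- Lemma 3.14: if `g` is convex and weakly analytic and constant on a
convex set `C`, then `g(y + v) = g(y)` for every `y` and every `v ∈ span(C − C)`. -/
theorem stmt_12 {p : ℕ} (g : EuclideanSpace ℝ (Fin p) → ℝ)
    (hgconv : ConvexOn ℝ Set.univ g)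
    (hgwa : WeaklyAnalytic g)
    (C : Set (EuclideanSpace ℝ (Fin p))) (hC : Convex ℝ C)
    (hconst : ∃ c : ℝ, ∀ y ∈ C, g y = c) :
    ∀ y : EuclideanSpace ℝ (Fin p), ∀ v ∈ Submodule.span ℝ (C - C),
      g (y + v) = g y := by
  obtain ⟨c, hc⟩ := hconst
  intro y v hv
  have key : ∀ (t : ℝ) (y : EuclideanSpace ℝ (Fin p)), g (y + t • v) = g y := by
    induction hv using Submodule.span_induction with
    | mem v hv =>
      obtain ⟨a, ha, b, hb, rfl⟩ := hv
      refine hgconv.apply_add_smul_eq_of_forall_apply_add_smul_le (x := b) (c := g b) fun t =>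
        (hgwa b (a - b) ⟨0, 1, one_pos, c, fun α hα => hc _ ?_⟩ t).le
      exact hC.add_smul_sub_mem hb ha ⟨hα.1.le, hα.2.le⟩
    | zero => simp
    | add a b _ _ iha ihb =>
      intro t y
      rw [smul_add, ← add_assoc, ihb, iha]
    | smul r a _ iha =>
      intro t y
      rw [smul_smul, iha]
  simpa using key 1 y
end

section
/- Let X ⊆ ℝ^d, let g_i : ℝ^p → ℝ for i = 0,…,k be convex and weakly analytic, and let φ_i : X → ℝ for i = 1,…,k be continuous. Suppose the feasible map K(x) = { y ∈ ℝ^p : g_i(y) ≤ φ_i(x), i = 1,…,k } has nonempty values for all x ∈ X, and that the ambient space Y, defined as the closed convex hull of ⋃_{x∈X} K(x), is compact. Then the solution map S(x) = argmin{ g₀(y) : y ∈ K(x) } is rectangularly continuous at every point x̄ ∈ X. -/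
open MeasureTheory Filter Topology Set Pointwise
open scoped ENNReal

/-- `Lim_{x→xb, x∈X} F(x) = C` in the sense of Kuratowski, via sequences. -/
def KuratowskiTendsto {d p : ℕ} (X : Set (EuclideanSpace ℝ (Fin d)))
    (F : EuclideanSpace ℝ (Fin d) → Set (EuclideanSpace ℝ (Fin p)))
    (xb : EuclideanSpace ℝ (Fin d)) (C : Set (EuclideanSpace ℝ (Fin p))) : Prop :=
  (∀ (xn : ℕ → EuclideanSpace ℝ (Fin d)) (yn : ℕ → EuclideanSpace ℝ (Fin p))
      (y : EuclideanSpace ℝ (Fin p)),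
    (∀ n, xn n ∈ X) → Tendsto xn atTop (𝓝 xb) → (∀ n, yn n ∈ F (xn n)) →
      Tendsto yn atTop (𝓝 y) → y ∈ C) ∧
  (∀ y ∈ C, ∀ xn : ℕ → EuclideanSpace ℝ (Fin d), (∀ n, xn n ∈ X) →
    Tendsto xn atTop (𝓝 xb) →
    ∃ yn : ℕ → EuclideanSpace ℝ (Fin p), (∀ n, yn n ∈ F (xn n)) ∧ Tendsto yn atTop (𝓝 y))

/-- Rectangular continuity of a set-valued map `S : X ⇉ ℝ^p` at `xb` (Definition 3.3). -/
def RectangularlyContinuousAt {d p : ℕ} (X : Set (EuclideanSpace ℝ (Fin d)))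
    (S : EuclideanSpace ℝ (Fin d) → Set (EuclideanSpace ℝ (Fin p)))
    (xb : EuclideanSpace ℝ (Fin d)) : Prop :=
  ∃ T₀ T₁ R₀ R₁ : EuclideanSpace ℝ (Fin d) → Set (EuclideanSpace ℝ (Fin p)),
    (∀ᶠ x in 𝓝[X] xb, T₀ x + R₀ x ⊆ S x ∧ S x ⊆ T₁ x + R₁ x) ∧
    (∀ x ∈ X,
      R₀ x ⊆ ((Submodule.span ℝ (T₀ x - T₀ x))ᗮ : Set (EuclideanSpace ℝ (Fin p))) ∩
          (Submodule.span ℝ (S x - S x) : Set (EuclideanSpace ℝ (Fin p))) ∧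
      R₁ x ⊆ ((Submodule.span ℝ (T₁ x - T₁ x))ᗮ : Set (EuclideanSpace ℝ (Fin p))) ∩
          (Submodule.span ℝ (S x - S x) : Set (EuclideanSpace ℝ (Fin p))) ∧
      adim (T₀ x) = adim (S xb) ∧ adim (T₁ x) = adim (S xb)) ∧
    KuratowskiTendsto X R₀ xb {0} ∧ KuratowskiTendsto X R₁ xb {0} ∧
    KuratowskiTendsto X T₀ xb (S xb) ∧ KuratowskiTendsto X T₁ xb (S xb) ∧
    (∀ x ∈ X, MeasurableSet (R₀ x) ∧ MeasurableSet (R₁ x)) ∧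
    Tendsto (fun x => (μH[((adim (S x) - adim (S xb) : ℕ) : ℝ)] (R₀ x)).toReal /
        (μH[((adim (S x) - adim (S xb) : ℕ) : ℝ)] (R₁ x)).toReal) (𝓝[X] xb) (𝓝 1)

section ConvexFunctions

variable {E : Type*} [NormedAddCommGroup E] [NormedSpace ℝ E]

/-- A continuous convex function which is constant along one line does not increase in the
direction of that line, at any base point. -/
theorem ConvexOn.apply_add_le_of_forall_line {g : E → ℝ} (hg : ConvexOn ℝ univ g)
    (hc : Continuous g) {a u : E} (h : ∀ t : ℝ, g (a + t • u) = g a) (y : E) :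
    g (y + u) ≤ g y := by
  have h1 : Tendsto (fun t : ℝ => g ((1 - t) • y + t • a + u)) (𝓝[>] 0) (𝓝 (g (y + u))) := by
    have : Continuous (fun t : ℝ => g ((1 - t) • y + t • a + u)) := by fun_prop
    simpa using (this.tendsto 0).mono_left nhdsWithin_le_nhds
  have h2 : Tendsto (fun t : ℝ => (1 - t) * g y + t * g a) (𝓝[>] 0) (𝓝 (g y)) := by
    have : Continuous (fun t : ℝ => (1 - t) * g y + t * g a) := by fun_prop
    simpa using (this.tendsto 0).mono_left nhdsWithin_le_nhds
  refine le_of_tendsto_of_tendsto h1 h2 ?_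
  filter_upwards [Ioo_mem_nhdsGT (zero_lt_one (α := ℝ))] with t ht
  have h3 := hg.2 (mem_univ y) (mem_univ (a + t⁻¹ • u)) (sub_nonneg.2 ht.2.le) ht.1.le
    (sub_add_cancel 1 t)
  rw [h, smul_add, smul_smul, mul_inv_cancel₀ ht.1.ne', one_smul, ← add_assoc] at h3
  simpa using h3

theorem ConvexOn.apply_add_eq_of_forall_line {g : E → ℝ} (hg : ConvexOn ℝ univ g)
    (hc : Continuous g) {a u : E} (h : ∀ t : ℝ, g (a + t • u) = g a) (y : E) :
    g (y + u) = g y := by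
  refine le_antisymm (hg.apply_add_le_of_forall_line hc h y) ?_
  have := hg.apply_add_le_of_forall_line hc (a := a) (u := -u)
    (fun t => by simpa using h (-t)) (y + u)
  simpa using this

end ConvexFunctions

/-- A convex weakly analytic function which is constant on a convex set is invariant under
translation by the linear span of the differences of that set. -/
theorem WeaklyAnalytic.apply_add_eq_of_mem_span {p : ℕ} {g : EuclideanSpace ℝ (Fin p) → ℝ}
    (hwa : WeaklyAnalytic g) (hg : ConvexOn ℝ univ g) (hc : Continuous g)
    {A : Set (EuclideanSpace ℝ (Fin p))} (hA : Convex ℝ A) {c : ℝ} (hAc : ∀ y ∈ A, g y = c)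
    {u : EuclideanSpace ℝ (Fin p)} (hu : u ∈ Submodule.span ℝ (A - A))
    (y : EuclideanSpace ℝ (Fin p)) : g (y + u) = g y := by
  suffices H : ∀ (t : ℝ) y, g (y + t • u) = g y by simpa using H 1 y
  induction hu using Submodule.span_induction with
  | mem u hu =>
    obtain ⟨a, ha, b, hb, rfl⟩ := Set.mem_sub.1 hu
    have key : ∀ t : ℝ, g (b + t • (a - b)) = g b := by
      refine hwa b (a - b) ⟨0, 1, one_pos, c, fun t ht => hAc _ ?_⟩
      have := hA hb ha (sub_nonneg.2 ht.2.le) ht.1.le (sub_add_cancel 1 t)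
      convert this using 1
      module
    intro t y
    refine hg.apply_add_eq_of_forall_line hc (a := b) (fun s => ?_) y
    rw [smul_smul, key]
  | zero => simp
  | add u v _ _ hu hv =>
    intro t y
    rw [smul_add, ← add_assoc, hv, hu]
  | smul r u _ hu =>
    intro t y
    rw [smul_smul, hu]

section SublevelSets

variable {ι E : Type*} [NormedAddCommGroup E]

/-- The set of solutions of the system of inequalities `g i y ≤ c i`. -/
def jointSublevel (g : ι → E → ℝ) (c : ι → ℝ) : Set E := {y | ∀ i, g i y ≤ c i}

theorem isClosed_jointSublevel {g : ι → E → ℝ} (hc : ∀ i, Continuous (g i)) (c : ι → ℝ) :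
    IsClosed (jointSublevel g c) := by
  simp only [jointSublevel, ofPred_forall]
  exact isClosed_iInter fun i => isClosed_le (hc i) continuous_const

theorem convex_jointSublevel [NormedSpace ℝ E] {g : ι → E → ℝ}
    (hg : ∀ i, ConvexOn ℝ univ (g i)) (c : ι → ℝ) : Convex ℝ (jointSublevel g c) := by
  simp only [jointSublevel, ofPred_forall]
  exact convex_iInter fun i => by simpa using (hg i).convex_le (c i)

theorem eventually_notMem_jointSublevel {D : Type*} {l : Filter D} {g : ι → E → ℝ}
    (hc : ∀ i, Continuous (g i)) {φ : ι → D → ℝ} {c : ι → ℝ}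
    (hφ : ∀ i, Tendsto (φ i) l (𝓝 (c i))) {y : E} (hy : y ∉ jointSublevel g c) :
    ∀ᶠ q in l ×ˢ 𝓝 y, q.2 ∉ jointSublevel g (fun i => φ i q.1) := by
  obtain ⟨i, hi⟩ : ∃ i, c i < g i y := by simpa [jointSublevel] using hy
  have h1 : Tendsto (fun q : D × E => φ i q.1) (l ×ˢ 𝓝 y) (𝓝 (c i)) :=
    (hφ i).comp tendsto_fst
  have h2 : Tendsto (fun q : D × E => g i q.2) (l ×ˢ 𝓝 y) (𝓝 (g i y)) :=
    ((hc i).tendsto y).comp tendsto_snd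
  filter_upwards [h1.eventually_lt h2 hi] with q hq hmem
  exact (hmem i).not_gt hq

theorem eventually_subset_of_isOpen {D : Type*} {l : Filter D} {F : D → Set E} {C Y U : Set E}
    (hY : IsCompact Y) (hFY : ∀ᶠ x in l, F x ⊆ Y)
    (hup : ∀ y ∉ C, ∀ᶠ q in l ×ˢ 𝓝 y, q.2 ∉ F q.1) (hU : IsOpen U) (hCU : C ⊆ U) :
    ∀ᶠ x in l, F x ⊆ U := by
  have h : {q : D × E | q.2 ∉ F q.1} ∈ l ×ˢ 𝓝ˢ (Y \ U) :=
    (hY.diff hU).mem_prod_nhdsSet_of_forall fun y hy => hup y fun h => hy.2 (hCU h)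
  obtain ⟨s, hs, t, ht, hst⟩ := mem_prod_iff.1 h
  filter_upwards [hs, hFY] with x hx hxY y hy
  by_contra hyU
  exact hst (mk_mem_prod hx (subset_of_mem_nhdsSet ht ⟨hxY hy, hyU⟩)) hy

/-- Some solution of a convex system satisfies strictly every inequality that can be satisfied
strictly. -/
theorem exists_strict_mem_jointSublevel [NormedSpace ℝ E] [Finite ι] {g : ι → E → ℝ}
    (hg : ∀ i, ConvexOn ℝ univ (g i)) {c : ι → ℝ} (hne : (jointSublevel g c).Nonempty) :
    ∃ y ∈ jointSublevel g c, ∀ i, (∃ z ∈ jointSublevel g c, g i z < c i) → g i y < c i := by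
  classical
  cases nonempty_fintype ι
  suffices H : ∀ J : Finset ι, ∃ y ∈ jointSublevel g c,
      ∀ i ∈ J, (∃ z ∈ jointSublevel g c, g i z < c i) → g i y < c i by
    simpa using H Finset.univ
  intro J
  induction J using Finset.induction_on with
  | empty => exact hne.imp fun y hy => ⟨hy, by simp⟩
  | insert j J _ ih =>
    obtain ⟨y, hy, hyJ⟩ := ih
    by_cases hj : ∃ z ∈ jointSublevel g c, g j z < c j
    · obtain ⟨z, hz, hzj⟩ := hj
      refine ⟨(1 / 2 : ℝ) • y + (1 / 2 : ℝ) • z, convex_jointSublevel hg c hy hz (by norm_num)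
        (by norm_num) (by norm_num), fun i hi hstrict => ?_⟩
      have h := (hg i).2 (mem_univ y) (mem_univ z) (half_pos one_pos).le (half_pos one_pos).le
        (add_halves 1)
      simp only [smul_eq_mul] at h
      have hy' := hy i
      have hz' := hz i
      rcases Finset.mem_insert.1 hi with rfl | hi
      · linarith
      · linarith [hyJ i hi hstrict]
    · refine ⟨y, hy, fun i hi hstrict => ?_⟩
      rcases Finset.mem_insert.1 hi with rfl | hi
      · exact absurd hstrict hj
      · exact hyJ i hi hstrict

end SublevelSets

/-- Stability of convex weakly analytic systems: near every solution `y` of the limit system there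
is a solution `z` such that the perturbed solution sets contain the product of a fixed relative
neighbourhood of `z`, in the directions of the limit solution set, with their own orthogonal
projections. -/
theorem exists_forall_add_mem_jointSublevel {p : ℕ} {ι D : Type*} [Finite ι] {l : Filter D}
    {g : ι → EuclideanSpace ℝ (Fin p) → ℝ} (hg : ∀ i, ConvexOn ℝ univ (g i))
    (hwa : ∀ i, WeaklyAnalytic (g i)) {φ : ι → D → ℝ} {c : ι → ℝ}
    (hφ : ∀ i, Tendsto (φ i) l (𝓝 (c i))) {Y : Set (EuclideanSpace ℝ (Fin p))}
    (hY : IsCompact Y) (hsub : ∀ᶠ x in l, jointSublevel g (fun i => φ i x) ⊆ Y)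
    {L : Submodule ℝ (EuclideanSpace ℝ (Fin p))}
    (hL : L = Submodule.span ℝ (jointSublevel g c - jointSublevel g c))
    {y : EuclideanSpace ℝ (Fin p)} (hy : y ∈ jointSublevel g c) {δ : ℝ} (hδ : 0 < δ) :
    ∃ z ∈ jointSublevel g c, dist z y < δ ∧ ∃ ε > 0, ∀ᶠ x in l, ∀ a ∈ L,
      dist a (L.starProjection z) < ε → ∀ s ∈ jointSublevel g (fun i => φ i x),
        a + (s - L.starProjection s) ∈ jointSublevel g (fun i => φ i x) := by
  have hc : ∀ i, Continuous (g i) := fun i => (hg i).locallyLipschitz.continuous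
  obtain ⟨y₀, hy₀, hstrict⟩ := exists_strict_mem_jointSublevel hg ⟨y, hy⟩
  obtain ⟨z, hz, hzy, hzstrict⟩ : ∃ z ∈ jointSublevel g c, dist z y < δ ∧
      ∀ i, (∃ w ∈ jointSublevel g c, g i w < c i) → g i z < c i := by
    have hlim : Tendsto (fun t : ℝ => (1 - t) • y + t • y₀) (𝓝[>] 0) (𝓝 y) := by
      have : Continuous (fun t : ℝ => (1 - t) • y + t • y₀) := by fun_prop
      simpa using (this.tendsto 0).mono_left nhdsWithin_le_nhds
    obtain ⟨t, hd, ht⟩ := ((hlim.eventually (Metric.ball_mem_nhds y hδ)).and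
      (Ioo_mem_nhdsGT (zero_lt_one (α := ℝ)))).exists
    refine ⟨_, convex_jointSublevel hg c hy hy₀ (sub_nonneg.2 ht.2.le) ht.1.le
      (sub_add_cancel 1 t), hd, fun i hi => ?_⟩
    have h := (hg i).2 (mem_univ y) (mem_univ y₀) (sub_nonneg.2 ht.2.le) ht.1.le
      (sub_add_cancel 1 t)
    have h1 := mul_lt_mul_of_pos_left (hstrict i hi) ht.1
    have h2 := mul_le_mul_of_nonneg_left (hy i) (sub_nonneg.2 ht.2.le)
    simp only [smul_eq_mul] at h
    linarith
  refine ⟨z, hz, hzy, ?_⟩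
  set P := L.starProjection with hP
  have hinv : ∀ i, (¬ ∃ w ∈ jointSublevel g c, g i w < c i) →
      ∀ u ∈ L, ∀ w, g i (w + u) = g i w := by
    intro i hi u hu w
    push Not at hi
    exact (hwa i).apply_add_eq_of_mem_span (hg i) (hc i) (convex_jointSublevel hg c)
      (fun w hw => le_antisymm (hw i) (hi w hw)) (hL ▸ hu) w
  have hPz : ∀ s ∈ jointSublevel g c, s - P s = z - P z := by
    intro s hs
    have : s - z ∈ L := hL ▸ Submodule.subset_span (Set.sub_mem_sub hs hz)
    have h : P (s - z) = s - z := Submodule.starProjection_eq_self_iff.2 this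
    rw [map_sub] at h
    rw [sub_eq_sub_iff_sub_eq_sub, h]
  -- the non-constant constraints remain strict close to `z`
  have hev : ∀ᶠ q in l ×ˢ 𝓝 z,
      ∀ i, (∃ w ∈ jointSublevel g c, g i w < c i) → g i q.2 < φ i q.1 := by
    rw [eventually_all]
    intro i
    by_cases hi : ∃ w ∈ jointSublevel g c, g i w < c i
    · have h1 : Tendsto (fun q : D × EuclideanSpace ℝ (Fin p) => φ i q.1) (l ×ˢ 𝓝 z)
        (𝓝 (c i)) := (hφ i).comp tendsto_fst
      have h2 : Tendsto (fun q : D × EuclideanSpace ℝ (Fin p) => g i q.2) (l ×ˢ 𝓝 z)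
        (𝓝 (g i z)) := ((hc i).tendsto z).comp tendsto_snd
      filter_upwards [h2.eventually_lt h1 (hzstrict i hi)] with q hq _ using hq
    · exact Eventually.of_forall fun q h => absurd h hi
  obtain ⟨A, hA, B, hB, hAB⟩ := mem_prod_iff.1 hev
  obtain ⟨r, hr, hrB⟩ := Metric.mem_nhds_iff.1 hB
  have hUopen : IsOpen {s | dist (s - P s) (z - P z) < r / 2} :=
    isOpen_lt (by fun_prop) continuous_const
  have hU := eventually_subset_of_isOpen hY hsub
    (fun w hw => eventually_notMem_jointSublevel hc hφ hw) hUopen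
    (fun s hs => by simp [hPz s hs, hr])
  refine ⟨r / 2, half_pos hr, ?_⟩
  filter_upwards [hA, hU] with x hxA hxU a haL ha s hs i
  by_cases hi : ∃ w ∈ jointSublevel g c, g i w < c i
  · refine (hAB (mk_mem_prod hxA (hrB ?_)) i hi).le
    have h1 : dist (s - P s) (z - P z) < r / 2 := hxU hs
    have h2 := dist_add_add_le a (s - P s) (P z) (z - P z)
    rw [add_sub_cancel] at h2
    exact Metric.mem_ball.2 (by linarith)
  · have h := hinv i hi (a - P s) (L.sub_mem haL (L.starProjection_apply_mem s)) s
    have e : a + (s - P s) = s + (a - P s) := by abel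
    rw [e, h]
    exact hs i

section Fibration

variable {E : Type*} [NormedAddCommGroup E] [InnerProductSpace ℝ E]

theorem Submodule.le_of_forall_dist_lt {L W : Submodule ℝ E} {b : E} {ε : ℝ} (hε : 0 < ε)
    (hb : b ∈ L) (h : ∀ a ∈ L, dist a b < ε → a - b ∈ W) : L ≤ W := by
  intro u hu
  obtain ⟨t, ht, htu⟩ : ∃ t : ℝ, 0 < t ∧ ‖t • u‖ < ε := by
    have hlim : Tendsto (fun t : ℝ => ‖t • u‖) (𝓝[>] 0) (𝓝 0) := by
      have : Continuous (fun t : ℝ => ‖t • u‖) := by fun_prop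
      simpa using (this.tendsto 0).mono_left nhdsWithin_le_nhds
    obtain ⟨t, h1, h2⟩ := ((hlim.eventually_lt_const hε).and self_mem_nhdsWithin).exists
    exact ⟨t, h2, h1⟩
  have h1 := h (b + t • u) (L.add_mem hb (L.smul_mem t hu)) (by simpa [dist_eq_norm] using htu)
  rw [add_sub_cancel_left] at h1
  exact (W.smul_mem_iff ht.ne').1 h1

theorem Submodule.span_image_add_sub_image_add {L : Submodule ℝ E} {B : Set E} {b : E} {ε : ℝ}
    (hε : 0 < ε) (hb : b ∈ L) (hB : B ⊆ L) (h : ∀ a ∈ L, dist a b < ε → a ∈ B) (q : E) :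
    Submodule.span ℝ ((q + ·) '' B - (q + ·) '' B) = L := by
  apply le_antisymm
  · rw [Submodule.span_le]
    rintro _ ⟨_, ⟨a, ha, rfl⟩, _, ⟨a', ha', rfl⟩, rfl⟩
    simpa using L.sub_mem (hB ha) (hB ha')
  · refine Submodule.le_of_forall_dist_lt hε hb fun a ha hab => Submodule.subset_span ?_
    exact ⟨_, mem_image_of_mem _ (h a ha hab), _, mem_image_of_mem _ (h b hb (by simpa)),
      add_sub_add_left_eq_sub _ _ _⟩

/-- A compact convex set containing the origin has positive and finite Hausdorff measure in the
dimension of its linear span. -/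
theorem hausdorffMeasure_finrank_span_pos_lt_top [FiniteDimensional ℝ E] [MeasurableSpace E]
    [BorelSpace E] {Q : Set E} (hconv : Convex ℝ Q) (hcomp : IsCompact Q) (h0 : (0 : E) ∈ Q) :
    0 < μH[(Module.finrank ℝ (Submodule.span ℝ Q) : ℝ)] Q ∧
      μH[(Module.finrank ℝ (Submodule.span ℝ Q) : ℝ)] Q < ∞ := by
  set V := Submodule.span ℝ Q with hV
  set Q' : Set V := (↑) ⁻¹' Q with hQ'
  have himg : ((↑) : V → E) '' Q' = Q :=
    image_preimage_eq_of_subset fun x hx => ⟨⟨x, Submodule.subset_span hx⟩, rfl⟩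
  have hiso : Isometry ((↑) : V → E) := V.subtypeₗᵢ.isometry
  have hμ : μH[(Module.finrank ℝ V : ℝ)] Q = μH[(Module.finrank ℝ V : ℝ)] Q' := by
    rw [← hiso.hausdorffMeasure_image (Or.inl (Nat.cast_nonneg _)), himg]
  have hconv' : Convex ℝ Q' := hconv.linear_preimage V.subtype
  have hcomp' : IsCompact Q' :=
    (Submodule.closed_of_finiteDimensional V).isClosedEmbedding_subtypeVal.isCompact_preimage hcomp
  have h0' : (0 : V) ∈ Q' := h0
  have hint : (interior Q').Nonempty := by
    rw [hconv'.interior_nonempty_iff_affineSpan_eq_top,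
      AffineSubspace.affineSpan_eq_top_iff_vectorSpan_eq_top_of_nonempty ℝ V V ⟨0, h0'⟩,
      vectorSpan_eq_span_vsub_set_right ℝ h0']
    have hspan : Submodule.span ℝ Q' = ⊤ := Submodule.span_span_coe_preimage
    simpa using hspan
  rw [hμ]
  exact ⟨Measure.measure_pos_of_nonempty_interior _ hint, hcomp'.measure_lt_top⟩

variable [FiniteDimensional ℝ E]

/-- The translates, by the component of `q` orthogonal to `L`, of all `a ∈ L` such that the whole
orthogonal projection of `S`, translated by `a`, is contained in `S`. -/
def innerBase (L : Submodule ℝ E) (q : E) (S : Set E) : Set E :=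
  (q - L.starProjection q + ·) '' {a | a ∈ L ∧ ∀ s ∈ S, a + (s - L.starProjection s) ∈ S}

/-- The orthogonal projection of `S` to `L`, translated by the component of `q` orthogonal
to `L`. -/
def outerBase (L : Submodule ℝ E) (q : E) (S : Set E) : Set E :=
  (q - L.starProjection q + ·) '' (L.starProjection '' S)

/-- The projection of `S` to the orthogonal complement of `L`, translated so that `q` is mapped
to the origin. -/
def orthFibre (L : Submodule ℝ E) (q : E) (S : Set E) : Set E :=
  (fun s => s - L.starProjection s - (q - L.starProjection q)) '' S

/-- The set `S` contains the product of a relative neighbourhood of a point of `L` and of the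
orthogonal projection of `S` to `Lᗮ`. -/
def HasProductBlock (L : Submodule ℝ E) (S : Set E) : Prop :=
  ∃ b ∈ L, ∃ ε > 0, ∀ a ∈ L, dist a b < ε → ∀ s ∈ S, a + (s - L.starProjection s) ∈ S

variable {L : Submodule ℝ E} {q : E} {S : Set E}

theorem innerBase_add_orthFibre_subset : innerBase L q S + orthFibre L q S ⊆ S := by
  rintro _ ⟨_, ⟨a, ⟨-, ha⟩, rfl⟩, _, ⟨s, hs, rfl⟩, rfl⟩
  convert ha s hs using 1
  simp only
  abel

theorem subset_outerBase_add_orthFibre : S ⊆ outerBase L q S + orthFibre L q S := by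
  intro s hs
  refine ⟨_, ⟨_, ⟨s, hs, rfl⟩, rfl⟩, _, ⟨s, hs, rfl⟩, ?_⟩
  simp only
  abel

theorem starProjection_sub_starProjection (L : Submodule ℝ E) (s : E) :
    L.starProjection (s - L.starProjection s) = 0 :=
  L.starProjection_apply_eq_zero_iff.2 (Submodule.sub_starProjection_mem_orthogonal s)

theorem innerBase_subset_outerBase (hq : q ∈ S) : innerBase L q S ⊆ outerBase L q S := by
  refine image_mono ?_
  rintro a ⟨haL, ha⟩
  refine ⟨_, ha q hq, ?_⟩
  rw [map_add, starProjection_sub_starProjection, add_zero,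
    Submodule.starProjection_eq_self_iff.2 haL]

theorem HasProductBlock.innerBase_nonempty (h : HasProductBlock L S) :
    (innerBase L q S).Nonempty := by
  obtain ⟨b, hb, ε, hε, h⟩ := h
  exact ⟨_, b, ⟨hb, h b hb (by simpa)⟩, rfl⟩

theorem HasProductBlock.span_innerBase (h : HasProductBlock L S) :
    Submodule.span ℝ (innerBase L q S - innerBase L q S) = L := by
  obtain ⟨b, hb, ε, hε, h⟩ := h
  refine Submodule.span_image_add_sub_image_add hε hb (fun a ha => ha.1) (fun a ha hab => ?_) _
  exact ⟨ha, h a ha hab⟩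

theorem HasProductBlock.span_outerBase (h : HasProductBlock L S) (hq : q ∈ S) :
    Submodule.span ℝ (outerBase L q S - outerBase L q S) = L := by
  obtain ⟨b, hb, ε, hε, h⟩ := h
  refine Submodule.span_image_add_sub_image_add hε hb ?_ (fun a ha hab => ?_) _
  · rintro _ ⟨s, -, rfl⟩
    exact L.starProjection_apply_mem s
  · refine ⟨_, h a ha hab q hq, ?_⟩
    rw [map_add, starProjection_sub_starProjection, add_zero,
      Submodule.starProjection_eq_self_iff.2 ha]

theorem orthFibre_subset_orthogonal : orthFibre L q S ⊆ (Lᗮ : Set E) := by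
  rintro _ ⟨s, -, rfl⟩
  exact Lᗮ.sub_mem (Submodule.sub_starProjection_mem_orthogonal s)
    (Submodule.sub_starProjection_mem_orthogonal q)

theorem HasProductBlock.orthFibre_subset_span (h : HasProductBlock L S) (hq : q ∈ S) :
    orthFibre L q S ⊆ (Submodule.span ℝ (S - S) : Set E) := by
  obtain ⟨b, hb, ε, hε, h⟩ := h
  rintro _ ⟨s, hs, rfl⟩
  have hb' := h b hb (by simpa)
  exact Submodule.subset_span ⟨_, hb' s hs, _, hb' q hq, add_sub_add_left_eq_sub _ _ _⟩

theorem zero_mem_orthFibre (hq : q ∈ S) : (0 : E) ∈ orthFibre L q S := ⟨q, hq, sub_self _⟩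

theorem isCompact_orthFibre (hS : IsCompact S) : IsCompact (orthFibre L q S) :=
  hS.image (by fun_prop)

theorem convex_orthFibre (hS : Convex ℝ S) : Convex ℝ (orthFibre L q S) := by
  have h := (hS.linear_image (LinearMap.id - L.starProjection.toLinearMap)).add
    (convex_singleton (𝕜 := ℝ) (-(q - L.starProjection q)))
  rw [Set.add_singleton, image_image] at h
  convert h using 1
  refine image_congr fun s _ => ?_
  simp [sub_eq_add_neg]

theorem HasProductBlock.finrank_span_orthFibre (h : HasProductBlock L S) (hq : q ∈ S) :
    Module.finrank ℝ (Submodule.span ℝ (orthFibre L q S)) =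
      Module.finrank ℝ (Submodule.span ℝ (S - S)) - Module.finrank ℝ L := by
  set V := Submodule.span ℝ (orthFibre L q S) with hV
  have hVL : V ≤ Lᗮ := Submodule.span_le.2 orthFibre_subset_orthogonal
  have hinf : L ⊓ V = ⊥ :=
    (Submodule.orthogonal_disjoint L).mono_right hVL |>.eq_bot
  have hsup : L ⊔ V = Submodule.span ℝ (S - S) := by
    apply le_antisymm
    · refine sup_le ?_ (Submodule.span_le.2 (h.orthFibre_subset_span hq))
      obtain ⟨b, hb, ε, hε, h⟩ := h
      exact Submodule.le_of_forall_dist_lt hε hb fun a ha hab => Submodule.subset_span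
        ⟨_, h a ha hab q hq, _, h b hb (by simpa) q hq, add_sub_add_right_eq_sub _ _ _⟩
    · rw [Submodule.span_le]
      rintro _ ⟨s, hs, t, ht, rfl⟩
      have h1 : L.starProjection (s - t) ∈ L ⊔ V :=
        Submodule.mem_sup_left (L.starProjection_apply_mem _)
      have h2 : ∀ r ∈ S, r - L.starProjection r - (q - L.starProjection q) ∈ L ⊔ V :=
        fun r hr => Submodule.mem_sup_right (Submodule.subset_span ⟨r, hr, rfl⟩)
      have h3 := (L ⊔ V).add_mem h1 ((L ⊔ V).sub_mem (h2 s hs) (h2 t ht))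
      rw [map_sub] at h3
      rw [SetLike.mem_coe]
      convert h3 using 1
      simp only
      abel
  have := Submodule.finrank_sup_add_finrank_inf_eq L V
  rw [hinf, hsup, finrank_bot] at this
  omega

end Fibration

/-- The affine dimension is the dimension of the linear span of the differences. -/
theorem adim_eq_finrank_span {p : ℕ} (A : Set (EuclideanSpace ℝ (Fin p))) :
    adim A = Module.finrank ℝ (Submodule.span ℝ (A - A)) := by
  rw [adim, direction_affineSpan]
  rfl

/-- A filter criterion for sequential Kuratowski convergence. -/
theorem KuratowskiTendsto.of_eventually {d p : ℕ} {X : Set (EuclideanSpace ℝ (Fin d))}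
    {F : EuclideanSpace ℝ (Fin d) → Set (EuclideanSpace ℝ (Fin p))}
    {xb : EuclideanSpace ℝ (Fin d)} {C : Set (EuclideanSpace ℝ (Fin p))}
    (hne : ∀ x ∈ X, (F x).Nonempty)
    (hup : ∀ y ∉ C, ∀ᶠ q in 𝓝[X] xb ×ˢ 𝓝 y, q.2 ∉ F q.1)
    (hlow : ∀ y ∈ C, ∀ ε > 0, ∀ᶠ x in 𝓝[X] xb, ∃ z ∈ F x, dist z y < ε) :
    KuratowskiTendsto X F xb C := by
  have hX : ∀ xn : ℕ → EuclideanSpace ℝ (Fin d), (∀ n, xn n ∈ X) → Tendsto xn atTop (𝓝 xb) →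
      Tendsto xn atTop (𝓝[X] xb) := fun xn hxn hlim =>
    tendsto_nhdsWithin_iff.2 ⟨hlim, Eventually.of_forall hxn⟩
  constructor
  · intro xn yn y hxn hlim hyn hy
    by_contra hyC
    obtain ⟨n, hn⟩ := (((hX xn hxn hlim).prodMk hy).eventually (hup y hyC)).exists
    exact hn (hyn n)
  · intro y hy xn hxn hlim
    have hchoose : ∀ n : ℕ, ∃ z ∈ F (xn n),
        dist y z < Metric.infDist y (F (xn n)) + 1 / ((n : ℝ) + 1) := fun n =>
      (Metric.infDist_lt_iff (hne _ (hxn n))).1 (lt_add_of_pos_right _ (by positivity))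
    choose yn hyn hdist using hchoose
    refine ⟨yn, hyn, ?_⟩
    rw [Metric.tendsto_atTop']
    intro ε hε
    have h1 := (hX xn hxn hlim).eventually (hlow y hy (ε / 2) (half_pos hε))
    have h2 := (tendsto_one_div_add_atTop_nhds_zero_nat (𝕜 := ℝ)).eventually_lt_const
      (half_pos hε)
    obtain ⟨N, hN⟩ := eventually_atTop.1 (h1.and h2)
    refine ⟨N, fun n hn => ?_⟩
    obtain ⟨⟨z, hz, hzy⟩, hn2⟩ := hN n hn.le
    have h3 := Metric.infDist_le_dist_of_mem (x := y) hz
    rw [dist_comm] at hzy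
    rw [dist_comm]
    linarith [hdist n]

/-- A compact convex valued map which is upper semicontinuous at `xb`, and whose values near `xb`
contain products of relative neighbourhoods of points of a dense subset of `S xb` with their
own orthogonal projections, is rectangularly continuous at `xb`. -/
theorem RectangularlyContinuousAt.of_productBlocks {d p : ℕ} {X : Set (EuclideanSpace ℝ (Fin d))}
    {S : EuclideanSpace ℝ (Fin d) → Set (EuclideanSpace ℝ (Fin p))}
    {xb : EuclideanSpace ℝ (Fin d)} (hxb : xb ∈ X)
    (hne : ∀ x ∈ X, (S x).Nonempty) (hconv : ∀ x ∈ X, Convex ℝ (S x))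
    (hcomp : ∀ x ∈ X, IsCompact (S x)) {Y : Set (EuclideanSpace ℝ (Fin p))} (hY : IsCompact Y)
    (hSY : ∀ x ∈ X, S x ⊆ Y)
    (hup : ∀ y ∉ S xb, ∀ᶠ q in 𝓝[X] xb ×ˢ 𝓝 y, q.2 ∉ S q.1)
    {L : Submodule ℝ (EuclideanSpace ℝ (Fin p))} (hL : L = Submodule.span ℝ (S xb - S xb))
    (hblock : ∀ y ∈ S xb, ∀ δ > 0, ∃ z ∈ S xb, dist z y < δ ∧ ∃ ε > 0, ∀ᶠ x in 𝓝[X] xb,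
      ∀ a ∈ L, dist a (L.starProjection z) < ε → ∀ s ∈ S x,
        a + (s - L.starProjection s) ∈ S x) :
    RectangularlyContinuousAt X S xb := by
  classical
  have hq : ∀ x, ∃ q, x ∈ X → q ∈ S x := fun x => by
    by_cases hx : x ∈ X
    · exact (hne x hx).imp fun q hq _ => hq
    · exact ⟨0, fun h => absurd h hx⟩
  choose q hq using hq
  have hX : ∀ᶠ x in 𝓝[X] xb, x ∈ X := eventually_mem_nhdsWithin
  have hgood : ∀ᶠ x in 𝓝[X] xb, HasProductBlock L (S x) := by
    obtain ⟨z, -, -, ε, hε, h⟩ := hblock _ (hq xb hxb) 1 one_pos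
    filter_upwards [h] with x hx
    exact ⟨_, L.starProjection_apply_mem z, ε, hε, hx⟩
  have horth : ∀ s ∈ S xb, s - L.starProjection s = q xb - L.starProjection (q xb) := by
    intro s hs
    have h : L.starProjection (s - q xb) = s - q xb := Submodule.starProjection_eq_self_iff.2
      (hL ▸ Submodule.subset_span (Set.sub_mem_sub hs (hq xb hxb)))
    rw [map_sub] at h
    rw [sub_eq_sub_iff_sub_eq_sub, h]
  have hnear : ∀ ε > 0, ∀ᶠ x in 𝓝[X] xb, ∀ s ∈ S x,
      dist (s - L.starProjection s) (q xb - L.starProjection (q xb)) < ε := by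
    intro ε hε
    have hU : IsOpen {s | dist (s - L.starProjection s) (q xb - L.starProjection (q xb)) < ε} :=
      isOpen_lt (by fun_prop) continuous_const
    have hSU : S xb ⊆
        {s | dist (s - L.starProjection s) (q xb - L.starProjection (q xb)) < ε} := by
      intro s hs
      rw [mem_ofPred_eq, horth s hs, dist_self]
      exact hε
    exact eventually_subset_of_isOpen hY (hX.mono hSY) hup hU hSU
  have hfibre : ∀ ε > 0, ∀ᶠ x in 𝓝[X] xb, ∀ r ∈ orthFibre L (q x) (S x), ‖r‖ < ε := by
    intro ε hε
    filter_upwards [hnear (ε / 2) (half_pos hε), hX] with x hx hxX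
    rintro _ ⟨s, hs, rfl⟩
    have h1 := dist_triangle_right (s - L.starProjection s) (q x - L.starProjection (q x))
      (q xb - L.starProjection (q xb))
    simp only
    rw [← dist_eq_norm]
    linarith [hx s hs, hx _ (hq x hxX)]
  have hupT : ∀ y ∉ S xb, ∀ᶠ z in 𝓝[X] xb ×ˢ 𝓝 y, z.2 ∉ outerBase L (q z.1) (S z.1) := by
    intro y hy
    obtain ⟨A, hA, B, hB, hAB⟩ := mem_prod_iff.1 (hup y hy)
    obtain ⟨r, hr, hrB⟩ := Metric.mem_nhds_iff.1 hB
    refine mem_prod_iff.2 ⟨_, inter_mem hA (hfibre (r / 2) (half_pos hr)), _,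
      Metric.ball_mem_nhds y (half_pos hr), ?_⟩
    rintro ⟨x, t⟩ ⟨⟨hxA, hx⟩, ht⟩ ⟨_, ⟨s, hs, rfl⟩, hst⟩
    refine hAB (mk_mem_prod hxA (hrB (a := s) ?_)) hs
    simp only at hst hs hx ht
    have h1 : ‖s - L.starProjection s - (q x - L.starProjection (q x))‖ < r / 2 :=
      hx _ ⟨s, hs, rfl⟩
    have h2 : s - L.starProjection s - (q x - L.starProjection (q x)) = s - t := by
      rw [← hst]; abel
    rw [h2, ← dist_eq_norm] at h1
    have h3 := dist_triangle s t y
    rw [Metric.mem_ball] at ht ⊢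
    linarith
  have hlowT : ∀ y ∈ S xb, ∀ ε > 0, ∀ᶠ x in 𝓝[X] xb,
      ∃ z ∈ innerBase L (q x) (S x), dist z y < ε := by
    intro y hy ε hε
    obtain ⟨z, hz, hzy, r, hr, hx⟩ := hblock y hy (ε / 2) (half_pos hε)
    filter_upwards [hx, hnear (ε / 2) (half_pos hε), hX] with x hx hxn hxX
    have hzL := L.starProjection_apply_mem z
    refine ⟨_, ⟨L.starProjection z, ⟨hzL, hx _ hzL (by simpa)⟩, rfl⟩, ?_⟩
    have h1 := hxn _ (hq x hxX)
    rw [← horth z hz] at h1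
    have h2 := dist_triangle (q x - L.starProjection (q x) + L.starProjection z) z y
    have h3 : dist (q x - L.starProjection (q x) + L.starProjection z) z =
        dist (q x - L.starProjection (q x)) (z - L.starProjection z) := by
      rw [dist_eq_norm, dist_eq_norm]
      congr 1
      abel
    simp only
    linarith
  set T₀ := fun x => if HasProductBlock L (S x) then innerBase L (q x) (S x) else S xb with hT₀
  set T₁ := fun x => if HasProductBlock L (S x) then outerBase L (q x) (S x) else S xb with hT₁
  set R := fun x => if HasProductBlock L (S x) then orthFibre L (q x) (S x) else {0} with hR
  have hT₀ne : ∀ x ∈ X, (T₀ x).Nonempty := by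
    intro x hx
    by_cases h : HasProductBlock L (S x)
    · simpa [hT₀, h] using h.innerBase_nonempty
    · simpa [hT₀, h] using hne xb hxb
  have hT₀T₁ : ∀ x ∈ X, T₀ x ⊆ T₁ x := by
    intro x hx
    by_cases h : HasProductBlock L (S x)
    · simpa [hT₀, hT₁, h] using innerBase_subset_outerBase (hq x hx)
    · simp [hT₀, hT₁, h]
  have hspan : ∀ x ∈ X, Submodule.span ℝ (T₀ x - T₀ x) = L ∧
      Submodule.span ℝ (T₁ x - T₁ x) = L := by
    intro x hx
    by_cases h : HasProductBlock L (S x)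
    · simpa [hT₀, hT₁, h] using And.intro h.span_innerBase (h.span_outerBase (hq x hx))
    · simp [hT₀, hT₁, h, ← hL]
  have hRsub : ∀ x ∈ X, R x ⊆ (Lᗮ : Set _) ∩ (Submodule.span ℝ (S x - S x) : Set _) := by
    intro x hx
    by_cases h : HasProductBlock L (S x)
    · simpa only [hR, h, if_true] using
        subset_inter orthFibre_subset_orthogonal (h.orthFibre_subset_span (hq x hx))
    · simp [hR, h]
  have hRzero : ∀ x ∈ X, (0 : EuclideanSpace ℝ (Fin p)) ∈ R x := by
    intro x hx
    by_cases h : HasProductBlock L (S x)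
    · simpa only [hR, h, if_true] using zero_mem_orthFibre (hq x hx)
    · simp [hR, h]
  have hRmeas : ∀ x ∈ X, MeasurableSet (R x) := by
    intro x hx
    by_cases h : HasProductBlock L (S x)
    · simpa only [hR, h, if_true] using (isCompact_orthFibre (hcomp x hx)).measurableSet
    · simp [hR, h]
  have hRlim : KuratowskiTendsto X R xb {0} := by
    refine .of_eventually (fun x hx => ⟨0, hRzero x hx⟩) (fun y hy => ?_) (fun y hy ε hε => ?_)
    · have hy' : 0 < ‖y‖ := norm_pos_iff.2 hy
      have h1 : ∀ᶠ z in 𝓝 y, ‖y‖ / 2 < ‖z‖ :=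
        continuous_norm.continuousAt.eventually_const_lt (half_lt_self hy')
      filter_upwards [((hfibre _ (half_pos hy')).and hgood).prod_mk h1] with z hz hzR
      simp only [hR, hz.1.2, if_true] at hzR
      exact lt_asymm (hz.1.1 _ hzR) hz.2
    · rw [mem_singleton_iff] at hy
      filter_upwards [hX] with x hx
      exact ⟨0, hRzero x hx, by simpa [hy] using hε⟩
  have hT₁up : ∀ y ∉ S xb, ∀ᶠ z in 𝓝[X] xb ×ˢ 𝓝 y, z.2 ∉ T₁ z.1 := by
    intro y hy
    filter_upwards [hupT y hy, tendsto_fst.eventually hgood] with z hz hz'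
    simpa only [hT₁, hz', if_true] using hz
  have hT₀low : ∀ y ∈ S xb, ∀ ε > 0, ∀ᶠ x in 𝓝[X] xb, ∃ z ∈ T₀ x, dist z y < ε := by
    intro y hy ε hε
    filter_upwards [hlowT y hy ε hε, hgood] with x hx hx'
    simpa only [hT₀, hx', if_true] using hx
  have hadim : adim (S xb) = Module.finrank ℝ L := by rw [adim_eq_finrank_span, ← hL]
  refine ⟨T₀, T₁, R, R, ?_, fun x hx => ?_, hRlim, hRlim, ?_, ?_,
    fun x hx => ⟨hRmeas x hx, hRmeas x hx⟩, ?_⟩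
  · filter_upwards [hgood] with x hx
    simpa only [hT₀, hT₁, hR, hx, if_true] using
      And.intro innerBase_add_orthFibre_subset subset_outerBase_add_orthFibre
  · obtain ⟨h0, h1⟩ := hspan x hx
    rw [h0, h1, hadim, adim_eq_finrank_span, adim_eq_finrank_span, h0, h1]
    exact ⟨hRsub x hx, hRsub x hx, rfl, rfl⟩
  · exact .of_eventually hT₀ne
      (fun y hy => (hT₁up y hy).and (tendsto_fst.eventually hX) |>.mono
        fun z hz h => hz.1 (hT₀T₁ _ hz.2 h)) hT₀low
  · exact .of_eventually (fun x hx => (hT₀ne x hx).mono (hT₀T₁ x hx)) hT₁up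
      fun y hy ε hε => ((hT₀low y hy ε hε).and hX).mono
        fun x ⟨⟨z, hz, hzy⟩, hx⟩ => ⟨z, hT₀T₁ x hx hz, hzy⟩
  · refine tendsto_const_nhds.congr' ?_
    filter_upwards [hgood, hX] with x hx hxX
    have hμ := hausdorffMeasure_finrank_span_pos_lt_top
      (convex_orthFibre (L := L) (q := q x) (hconv x hxX)) (isCompact_orthFibre (hcomp x hxX))
      (zero_mem_orthFibre (hq x hxX))
    rw [hx.finrank_span_orthFibre (hq x hxX)] at hμ
    rw [hadim, adim_eq_finrank_span]
    simp only [hR, hx, if_true]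
    rw [div_self (ENNReal.toReal_pos hμ.1.ne' hμ.2.ne).ne']

/-- Theorem 3.16: the solution map of a parametric convex problem with
convex weakly analytic data `g₀, …, g_k`, continuous right-hand sides `φ₁, …, φ_k`,
nonempty feasible values, and compact ambient space
`Y = cl co (⋃_{x∈X} K(x))`, is rectangularly continuous at every point of `X`. -/
theorem stmt_13 {d p k : ℕ}
    (X : Set (EuclideanSpace ℝ (Fin d)))
    (g : Fin (k + 1) → EuclideanSpace ℝ (Fin p) → ℝ)
    (hgconv : ∀ i, ConvexOn ℝ Set.univ (g i))
    (hgwa : ∀ i, WeaklyAnalytic (g i))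
    (φ : Fin k → EuclideanSpace ℝ (Fin d) → ℝ)
    (hφ : ∀ i, ContinuousOn (φ i) X)
    -- the feasible map and its nonemptiness
    (K : EuclideanSpace ℝ (Fin d) → Set (EuclideanSpace ℝ (Fin p)))
    (hKdef : ∀ x, K x = {y | ∀ i : Fin k, g i.succ y ≤ φ i x})
    (hKne : ∀ x ∈ X, (K x).Nonempty)
    -- the ambient space is compact
    (hYcomp : IsCompact (closure (convexHull ℝ (⋃ x ∈ X, K x))))
    -- the solution map
    (S : EuclideanSpace ℝ (Fin d) → Set (EuclideanSpace ℝ (Fin p)))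
    (hSdef : ∀ x, S x = {y ∈ K x | ∀ z ∈ K x, g 0 y ≤ g 0 z}) :
    ∀ xb ∈ X, RectangularlyContinuousAt X S xb := by
  intro xb hxb
  have hc : ∀ i, Continuous (g i) := fun i => (hgconv i).locallyLipschitz.continuous
  have hKY : ∀ x ∈ X, K x ⊆ closure (convexHull ℝ (⋃ x ∈ X, K x)) := fun x hx =>
    (subset_biUnion_of_mem (u := K) hx).trans ((subset_convexHull ℝ _).trans subset_closure)
  have hKeq : ∀ x, K x = jointSublevel (fun i : Fin k => g i.succ) (fun i => φ i x) := hKdef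
  have hKcomp : ∀ x ∈ X, IsCompact (K x) := fun x hx =>
    hYcomp.of_isClosed_subset (hKeq x ▸ isClosed_jointSublevel (fun i : Fin k => hc i.succ) _)
      (hKY x hx)
  have hSne : ∀ x ∈ X, (S x).Nonempty := fun x hx => by
    obtain ⟨y, hy, hmin⟩ := (hKcomp x hx).exists_isMinOn (hKne x hx) (hc 0).continuousOn
    exact ⟨y, by rw [hSdef]; exact ⟨hy, fun z hz => hmin hz⟩⟩
  have hv : ∀ x, ∃ v : ℝ, x ∈ X → (∃ y ∈ K x, g 0 y = v) ∧ ∀ z ∈ K x, v ≤ g 0 z := fun x => by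
    by_cases hx : x ∈ X
    · obtain ⟨y, hy⟩ := hSne x hx
      rw [hSdef] at hy
      exact ⟨g 0 y, fun _ => ⟨⟨y, hy.1, rfl⟩, hy.2⟩⟩
    · exact ⟨0, fun h => absurd h hx⟩
  choose v hv using hv
  have hX : ∀ᶠ x in 𝓝[X] xb, x ∈ X := eventually_mem_nhdsWithin
  have hφlim : ∀ i, Tendsto (φ i) (𝓝[X] xb) (𝓝 (φ i xb)) := fun i => hφ i xb hxb
  have hvlim : Tendsto v (𝓝[X] xb) (𝓝 (v xb)) := by
    have hKup : ∀ y ∉ K xb, ∀ᶠ q in 𝓝[X] xb ×ˢ 𝓝 y, q.2 ∉ K q.1 := fun y hy => by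
      simp only [hKeq] at hy ⊢
      exact eventually_notMem_jointSublevel (g := fun i : Fin k => g i.succ)
        (fun i => hc i.succ) hφlim hy
    obtain ⟨⟨y, hy, hyv⟩, hmin⟩ := hv xb hxb
    refine tendsto_order.2 ⟨fun a ha => ?_, fun a ha => ?_⟩
    · filter_upwards [eventually_subset_of_isOpen hYcomp (hX.mono hKY) hKup
        (isOpen_lt continuous_const (hc 0)) (fun z hz => ha.trans_le (hmin z hz)), hX] with x hx hxX
      obtain ⟨⟨z, hz, hzv⟩, -⟩ := hv x hxX
      exact hzv ▸ hx hz
    · rw [← hyv] at ha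
      obtain ⟨δ, hδ, hball⟩ := Metric.mem_nhds_iff.1 ((hc 0).continuousAt.eventually_lt_const ha)
      set L := Submodule.span ℝ (K xb - K xb) with hL
      obtain ⟨z, hz, hzy, ε, hε, hblock⟩ := exists_forall_add_mem_jointSublevel
        (fun i => hgconv i.succ) (fun i => hgwa i.succ) hφlim hYcomp
        (hX.mono fun x hx => hKeq x ▸ hKY x hx) (L := L) (by rw [hL, hKeq]) (hKeq xb ▸ hy)
        (half_pos hδ)
      rw [← hKeq] at hz
      simp only [← hKeq] at hblock
      have hU : IsOpen {s | dist (s - L.starProjection s) (z - L.starProjection z) < δ / 2} :=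
        isOpen_lt (by fun_prop) continuous_const
      have hnear := eventually_subset_of_isOpen hYcomp (hX.mono hKY) hKup hU fun s hs => by
        have h : L.starProjection (s - z) = s - z := Submodule.starProjection_eq_self_iff.2
          (Submodule.subset_span (Set.sub_mem_sub hs hz))
        rw [map_sub] at h
        have h' : s - L.starProjection s = z - L.starProjection z := by
          rw [sub_eq_sub_iff_sub_eq_sub, h]
        simpa [h'] using hδ
      filter_upwards [hblock, hnear, hX] with x hx hxn hxX
      obtain ⟨s, hs⟩ := hKne x hxX
      have hmem := hx _ (L.starProjection_apply_mem z) (by simpa) s hs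
      refine ((hv x hxX).2 _ hmem).trans_lt (hball (Metric.mem_ball.2 ?_))
      have h1 : dist (s - L.starProjection s) (z - L.starProjection z) < δ / 2 := hxn hs
      have h2 := dist_triangle (L.starProjection z + (s - L.starProjection s)) z y
      have h3 : dist (L.starProjection z + (s - L.starProjection s)) z =
          dist (s - L.starProjection s) (z - L.starProjection z) := by
        rw [dist_eq_norm, dist_eq_norm]
        congr 1
        abel
      linarith
  -- the solution set is itself described by a system of convex weakly analytic inequalities
  set ψ : Fin (k + 1) → EuclideanSpace ℝ (Fin d) → ℝ := Fin.cons v φ with hψ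
  have hψlim : ∀ i, Tendsto (ψ i) (𝓝[X] xb) (𝓝 (ψ i xb)) := fun i => by
    refine Fin.cases ?_ (fun j => ?_) i
    · simpa [hψ] using hvlim
    · simpa [hψ] using hφlim j
  have hSeq : ∀ x ∈ X, S x = jointSublevel g (fun i => ψ i x) := by
    intro x hx
    obtain ⟨⟨y, hy, hyv⟩, hmin⟩ := hv x hx
    ext z
    rw [hSdef, hKeq]
    simp only [jointSublevel, mem_ofPred_eq, Fin.forall_fin_succ, hψ, Fin.cons_zero, Fin.cons_succ]
    rw [hKeq] at hy hmin
    exact ⟨fun h => ⟨hyv ▸ h.2 y hy, h.1⟩, fun h => ⟨h.2, fun w hw => h.1.trans (hmin w hw)⟩⟩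
  have hSY : ∀ x ∈ X, S x ⊆ closure (convexHull ℝ (⋃ x ∈ X, K x)) := fun x hx y hy => by
    rw [hSdef] at hy
    exact hKY x hx hy.1
  refine .of_productBlocks hxb hSne (fun x hx => hSeq x hx ▸ convex_jointSublevel hgconv _)
    (fun x hx => hYcomp.of_isClosed_subset (hSeq x hx ▸ isClosed_jointSublevel hc _) (hSY x hx))
    hYcomp hSY (fun y hy => ?_) rfl (fun y hy δ hδ => ?_)
  · rw [hSeq xb hxb] at hy
    filter_upwards [eventually_notMem_jointSublevel hc hψlim hy, tendsto_fst.eventually hX]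
      with q hq hqX
    rwa [hSeq _ hqX]
  · rw [hSeq xb hxb] at hy ⊢
    obtain ⟨z, hz, hzy, ε, hε, h⟩ := exists_forall_add_mem_jointSublevel hgconv hgwa hψlim hYcomp
      (hX.mono fun x hx => hSeq x hx ▸ hSY x hx) rfl hy hδ
    refine ⟨z, hz, hzy, ε, hε, ?_⟩
    filter_upwards [h, hX] with x hx hxX
    rwa [hSeq x hxX]
end

section
/- Let X ⊆ ℝ^d and let T : X ⇉ ℝ^p be a set-valued map with nonempty convex compact values, all of the same affine dimension k, which is continuous at x̄ ∈ X. Define L(x) = span(T(x) − T(x)) and R(x) = B ∩ L(x)^⊥, where B is the closed unit ball of ℝ^p. Then R is (Kuratowski) continuous at x̄: for every sequence x_n → x̄ in X, (i) every limit of a convergent sequence y_n ∈ R(x_n) belongs to R(x̄), and (ii) for every y ∈ R(x̄) there exist y_n ∈ R(x_n) with y_n → y. Consequently the map D(x) = T(x) + R(x) (Minkowski sum) is also continuous at x̄. -/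
open MeasureTheory Filter Topology Set Pointwise
open scoped ENNReal

/-- In finite dimension, the component of `y` in `span S` is controlled by the inner products of `y`
with the elements of `S`. -/
lemma exists_norm_starProjection_span_le {E : Type*} [NormedAddCommGroup E]
    [InnerProductSpace ℝ E] [FiniteDimensional ℝ E] (S : Set E) :
    ∃ C > (0 : ℝ), ∀ (y : E) (M : ℝ), 0 ≤ M → (∀ v ∈ S, |inner ℝ v y| ≤ M) →
      ‖(Submodule.span ℝ S).starProjection y‖ ≤ C * M := by
  obtain ⟨t, htS, ht⟩ := (Submodule.fg_span_iff_fg_span_finset_subset S).1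
    (IsNoetherian.noetherian (Submodule.span ℝ S))
  let f : Submodule.span ℝ S →ₗ[ℝ] (t → ℝ) :=
    LinearMap.pi fun v => (innerₛₗ ℝ (v : E)) ∘ₗ (Submodule.span ℝ S).subtype
  have hf : LinearMap.ker f = ⊥ := by
    rw [LinearMap.ker_eq_bot']
    intro u hu
    have hu' : (u : E) ∈ (Submodule.span ℝ S)ᗮ := by
      rw [Submodule.mem_orthogonal]
      intro w hw
      rw [ht] at hw
      induction hw using Submodule.span_induction with
      | mem v hv => exact congrFun hu ⟨v, hv⟩
      | zero => simp
      | add a b _ _ ha hb => rw [inner_add_left, ha, hb, add_zero]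
      | smul c a _ ha => rw [real_inner_smul_left, ha, mul_zero]
    exact Subtype.ext (inner_self_eq_zero.1 (hu' u u.2))
  obtain ⟨K, hK, hKf⟩ := LinearMap.exists_antilipschitzWith f hf
  refine ⟨K, hK, fun y M hM hy => ?_⟩
  have h := ZeroHomClass.bound_of_antilipschitz f hKf
    ((Submodule.span ℝ S).orthogonalProjectionOnto y)
  refine h.trans (mul_le_mul_of_nonneg_left ((pi_norm_le_iff_of_nonneg hM).2 fun v => ?_) K.2)
  have hv : (v : E) ∈ Submodule.span ℝ S := Submodule.subset_span (htS v.2)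
  have : f ((Submodule.span ℝ S).orthogonalProjectionOnto y) v = inner ℝ (v : E) y :=
    Submodule.inner_orthogonalProjectionOnto_eq_of_mem_left (⟨v, hv⟩ : Submodule.span ℝ S) y
  rw [this]
  exact hy v (htS v.2)

/-- For subspaces of equal dimension, closeness of `U` to `V` implies closeness of `V` to `U`. -/
lemma norm_sub_starProjection_le_of_finrank_eq {E : Type*} [NormedAddCommGroup E]
    [InnerProductSpace ℝ E] [FiniteDimensional ℝ E] {U V : Submodule ℝ E}
    (hUV : Module.finrank ℝ U = Module.finrank ℝ V) {ε : ℝ} (hε₀ : 0 ≤ ε)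
    (hε : ε ≤ 1 / 2)
    (h : ∀ u ∈ U, ‖u - V.starProjection u‖ ≤ ε * ‖u‖) {v : E} (hv : v ∈ V) :
    ‖v - U.starProjection v‖ ≤ 2 * ε * ‖v‖ := by
  have hle : ∀ u ∈ U, ‖u‖ ≤ 2 * ‖V.starProjection u‖ := fun u hu => by
    have h1 := h u hu
    have h2 := norm_sub_norm_le u (V.starProjection u)
    nlinarith [norm_nonneg u]
  let f : U →ₗ[ℝ] V := V.orthogonalProjectionOnto.toLinearMap ∘ₗ U.subtype
  have hf : Function.Injective f := by
    rw [injective_iff_map_eq_zero]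
    intro u hu
    have h0 : V.starProjection (u : E) = 0 := congrArg Subtype.val hu
    have h1 := hle u u.2
    rw [h0, norm_zero, mul_zero] at h1
    exact Subtype.ext (norm_le_zero_iff.1 h1)
  obtain ⟨u, hu⟩ := (LinearMap.injective_iff_surjective_of_finrank_eq_finrank hUV).1 hf ⟨v, hv⟩
  have huv : V.starProjection (u : E) = v := congrArg Subtype.val hu
  have h1 := h u u.2
  have h2 := hle u u.2
  rw [huv] at h1 h2
  have h3 : ‖v - U.starProjection v‖ ≤ ‖v - u‖ := by
    rw [Submodule.starProjection_minimal]
    exact ciInf_le ⟨0, by rintro _ ⟨w, rfl⟩; exact norm_nonneg _⟩ u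
  rw [norm_sub_rev v u] at h3
  nlinarith

lemma finrank_span_sub_eq_adim {p : ℕ} (A : Set (EuclideanSpace ℝ (Fin p))) :
    Module.finrank ℝ (Submodule.span ℝ (A - A)) = adim A := by
  rw [adim, direction_affineSpan]
  rfl

lemma abs_inner_le_of_subset_add_closedBall {E : Type*} [NormedAddCommGroup E]
    [InnerProductSpace ℝ E] {A B : Set E} {ε : ℝ} (h : A ⊆ B + Metric.closedBall 0 ε) {y : E}
    (hy : y ∈ (Submodule.span ℝ (B - B))ᗮ) {v : E} (hv : v ∈ A - A) :
    |inner ℝ v y| ≤ 2 * ε * ‖y‖ := by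
  obtain ⟨a, ha, a', ha', rfl⟩ := hv
  obtain ⟨b, hb, e, he, rfl⟩ := h ha
  obtain ⟨b', hb', e', he', rfl⟩ := h ha'
  have h0 : inner ℝ (b - b') y = 0 := hy _ (Submodule.subset_span (Set.sub_mem_sub hb hb'))
  have h1 : b + e - (b' + e') = (b - b') + (e - e') := by abel
  rw [mem_closedBall_zero_iff] at he he'
  simp only [h1, inner_add_left, h0, zero_add]
  refine (abs_real_inner_le_norm _ _).trans
    (mul_le_mul_of_nonneg_right ?_ (norm_nonneg y))
  linarith [norm_sub_le e e']

/-- A continuous set-valued map of constant affine dimension has continuous orthogonal complements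
of its spans of differences. -/
lemma SVContinuousAt.orthogonal_span_sub {d p : ℕ} {X : Set (EuclideanSpace ℝ (Fin d))}
    {T : EuclideanSpace ℝ (Fin d) → Set (EuclideanSpace ℝ (Fin p))}
    {xb : EuclideanSpace ℝ (Fin d)} (hT : SVContinuousAt X T xb)
    (hdim : ∀ x ∈ X, adim (T x) = adim (T xb)) {ε : ℝ} (hε : 0 < ε) :
    ∃ δ > (0 : ℝ), ∀ x ∈ X, ‖x - xb‖ < δ →
      (∀ y ∈ (Submodule.span ℝ (T x - T x))ᗮ,
        ‖y - (Submodule.span ℝ (T xb - T xb))ᗮ.starProjection y‖ ≤ ε * ‖y‖) ∧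
      (∀ y ∈ (Submodule.span ℝ (T xb - T xb))ᗮ,
        ‖y - (Submodule.span ℝ (T x - T x))ᗮ.starProjection y‖ ≤ ε * ‖y‖) := by
  obtain ⟨C, hC, hCb⟩ := exists_norm_starProjection_span_le (T xb - T xb)
  obtain ⟨η, hη, hηε, hη2⟩ : ∃ η > (0 : ℝ), 2 * η ≤ ε ∧ η ≤ 1 / 2 :=
    ⟨min (ε / 2) (1 / 2), by positivity, by linarith [min_le_left (ε / 2) (1 / 2)],
      min_le_right _ _⟩
  obtain ⟨δ, hδ, hδT⟩ := hT (η / (2 * C)) (by positivity)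
  refine ⟨δ, hδ, fun x hx hxδ => ?_⟩
  have key : ∀ y ∈ (Submodule.span ℝ (T x - T x))ᗮ,
      ‖y - (Submodule.span ℝ (T xb - T xb))ᗮ.starProjection y‖ ≤ η * ‖y‖ := fun y hy => by
    have h := hCb y (2 * (η / (2 * C)) * ‖y‖) (by positivity) fun v hv =>
      abs_inner_le_of_subset_add_closedBall (hδT x hx hxδ).2 hy hv
    have h1 : C * (2 * (η / (2 * C)) * ‖y‖) = η * ‖y‖ := by field_simp
    rw [h1] at h
    rwa [Submodule.starProjection_orthogonal_val, sub_sub_cancel]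
  have hrank : Module.finrank ℝ (Submodule.span ℝ (T x - T x))ᗮ =
      Module.finrank ℝ (Submodule.span ℝ (T xb - T xb))ᗮ := by
    have h1 := Submodule.finrank_add_finrank_orthogonal (Submodule.span ℝ (T x - T x))
    have h2 := Submodule.finrank_add_finrank_orthogonal (Submodule.span ℝ (T xb - T xb))
    rw [finrank_span_sub_eq_adim] at h1 h2
    have := hdim x hx
    omega
  refine ⟨fun y hy => (key y hy).trans ?_, fun y hy =>
    (norm_sub_starProjection_le_of_finrank_eq hrank hη.le hη2 key hy).trans ?_⟩ <;>
  exact mul_le_mul_of_nonneg_right (by linarith) (norm_nonneg y)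

lemma closedBall_inter_subset_add_closedBall {E : Type*} [NormedAddCommGroup E]
    [InnerProductSpace ℝ E] [FiniteDimensional ℝ E] {U V : Submodule ℝ E} {ε : ℝ} (hε : 0 ≤ ε)
    (h : ∀ u ∈ U, ‖u - V.starProjection u‖ ≤ ε * ‖u‖) :
    Metric.closedBall 0 1 ∩ (U : Set E) ⊆
      Metric.closedBall 0 1 ∩ (V : Set E) + Metric.closedBall 0 ε := by
  rintro y ⟨hy1, hyU⟩
  rw [mem_closedBall_zero_iff] at hy1
  refine ⟨V.starProjection y, ⟨?_, V.starProjection_apply_mem y⟩, y - V.starProjection y, ?_,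
    add_sub_cancel _ _⟩
  · rw [mem_closedBall_zero_iff]
    exact (V.norm_starProjection_apply_le y).trans hy1
  · rw [mem_closedBall_zero_iff]
    exact (h y hyU).trans (mul_le_of_le_one_right hε hy1)

lemma SVContinuousAt.add {d p : ℕ} {X : Set (EuclideanSpace ℝ (Fin d))}
    {S T : EuclideanSpace ℝ (Fin d) → Set (EuclideanSpace ℝ (Fin p))}
    {xb : EuclideanSpace ℝ (Fin d)} (hS : SVContinuousAt X S xb) (hT : SVContinuousAt X T xb) :
    SVContinuousAt X (fun x => S x + T x) xb := by
  intro ε hε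
  obtain ⟨δ₁, hδ₁, h₁⟩ := hS (ε / 2) (half_pos hε)
  obtain ⟨δ₂, hδ₂, h₂⟩ := hT (ε / 2) (half_pos hε)
  have aux : ∀ {A A' B B' : Set (EuclideanSpace ℝ (Fin p))},
      A ⊆ A' + Metric.closedBall 0 (ε / 2) → B ⊆ B' + Metric.closedBall 0 (ε / 2) →
      A + B ⊆ A' + B' + Metric.closedBall 0 ε := fun {A A' B B'} hA hB => by
    refine (Set.add_subset_add hA hB).trans ?_
    rw [add_add_add_comm, closedBall_add_closedBall (half_pos hε).le (half_pos hε).le, add_zero,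
      add_halves]
  refine ⟨min δ₁ δ₂, lt_min hδ₁ hδ₂, fun x hx hxδ => ?_⟩
  obtain ⟨a₁, b₁⟩ := h₁ x hx (hxδ.trans_le (min_le_left _ _))
  obtain ⟨a₂, b₂⟩ := h₂ x hx (hxδ.trans_le (min_le_right _ _))
  exact ⟨aux a₁ a₂, aux b₁ b₂⟩

/-- if `T : X ⇉ ℝ^p` has nonempty convex compact values of constant
affine dimension `k` and is continuous at `xb`, then `R(x) = B ∩ L(x)^⊥`, with
`L(x) = span(T(x) − T(x))`, is Kuratowski continuous at `xb`, and consequently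
`D(x) = T(x) + R(x)` is continuous at `xb`. -/
theorem stmt_16 {d p : ℕ}
    (X : Set (EuclideanSpace ℝ (Fin d)))
    (T : EuclideanSpace ℝ (Fin d) → Set (EuclideanSpace ℝ (Fin p)))
    (hTne : ∀ x ∈ X, (T x).Nonempty)
    (hTconv : ∀ x ∈ X, Convex ℝ (T x))
    (hTcomp : ∀ x ∈ X, IsCompact (T x))
    (k : ℕ) (hTdim : ∀ x ∈ X, adim (T x) = k)
    (xb : EuclideanSpace ℝ (Fin d)) (hxb : xb ∈ X)
    (hTcont : SVContinuousAt X T xb)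
    (R : EuclideanSpace ℝ (Fin d) → Set (EuclideanSpace ℝ (Fin p)))
    (hRdef : ∀ x, R x = Metric.closedBall 0 1 ∩
      ((Submodule.span ℝ (T x - T x))ᗮ : Set (EuclideanSpace ℝ (Fin p)))) :
    -- (i) outer Kuratowski semicontinuity of `R` at `xb`
    ((∀ (xn : ℕ → EuclideanSpace ℝ (Fin d)) (yn : ℕ → EuclideanSpace ℝ (Fin p))
        (y : EuclideanSpace ℝ (Fin p)),
      (∀ n, xn n ∈ X) → Tendsto xn atTop (𝓝 xb) → (∀ n, yn n ∈ R (xn n)) →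
        Tendsto yn atTop (𝓝 y) → y ∈ R xb) ∧
    -- (ii) inner Kuratowski semicontinuity of `R` at `xb`
    (∀ y ∈ R xb, ∀ xn : ℕ → EuclideanSpace ℝ (Fin d), (∀ n, xn n ∈ X) →
      Tendsto xn atTop (𝓝 xb) →
      ∃ yn : ℕ → EuclideanSpace ℝ (Fin p), (∀ n, yn n ∈ R (xn n)) ∧
        Tendsto yn atTop (𝓝 y))) ∧
    -- consequently `D = T + R` is continuous at `xb`
    SVContinuousAt X (fun x => T x + R x) xb := by
  have hdim : ∀ x ∈ X, adim (T x) = adim (T xb) := fun x hx => by rw [hTdim x hx, hTdim xb hxb]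
  refine ⟨⟨fun xn yn y hxX hx hyR hy => ?_, fun y hyR xn hxX hx => ?_⟩, hTcont.add ?_⟩
  · simp only [hRdef] at hyR ⊢
    refine ⟨Metric.isClosed_closedBall.mem_of_tendsto hy (Eventually.of_forall fun n => (hyR n).1),
      ?_⟩
    have hlim : Tendsto (fun n => yn n - (Submodule.span ℝ (T xb - T xb))ᗮ.starProjection (yn n))
        atTop (𝓝 0) := by
      rw [Metric.tendsto_atTop']
      intro ε hε
      obtain ⟨δ, hδ, h⟩ := hTcont.orthogonal_span_sub hdim (half_pos hε)
      obtain ⟨N, hN⟩ := Metric.tendsto_atTop'.1 hx δ hδ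
      refine ⟨N, fun n hn => ?_⟩
      have h1 := (h (xn n) (hxX n) (by simpa [dist_eq_norm] using hN n hn)).1 (yn n) (hyR n).2
      have h2 := mem_closedBall_zero_iff.1 (hyR n).1
      rw [dist_zero_right]
      nlinarith
    have hlim' := hy.sub
      (((Submodule.span ℝ (T xb - T xb))ᗮ.starProjection.continuous.tendsto y).comp hy)
    exact Submodule.starProjection_eq_self_iff.1
      (sub_eq_zero.1 (tendsto_nhds_unique hlim' hlim)).symm
  · simp only [hRdef] at hyR ⊢
    have hy1 := mem_closedBall_zero_iff.1 hyR.1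
    refine ⟨fun n => (Submodule.span ℝ (T (xn n) - T (xn n)))ᗮ.starProjection y, fun n =>
      ⟨mem_closedBall_zero_iff.2 ((Submodule.norm_starProjection_apply_le _ y).trans hy1),
        Submodule.starProjection_apply_mem _ y⟩, ?_⟩
    rw [Metric.tendsto_atTop']
    intro ε hε
    obtain ⟨δ, hδ, h⟩ := hTcont.orthogonal_span_sub hdim (half_pos hε)
    obtain ⟨N, hN⟩ := Metric.tendsto_atTop'.1 hx δ hδ
    refine ⟨N, fun n hn => ?_⟩
    have h1 := (h (xn n) (hxX n) (by simpa [dist_eq_norm] using hN n hn)).2 y hyR.2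
    rw [dist_comm, dist_eq_norm]
    nlinarith
  · intro ε hε
    obtain ⟨δ, hδ, h⟩ := hTcont.orthogonal_span_sub hdim hε
    refine ⟨δ, hδ, fun x hx hxδ => ?_⟩
    simp only [hRdef]
    exact ⟨closedBall_inter_subset_add_closedBall hε.le (h x hx hxδ).1,
      closedBall_inter_subset_add_closedBall hε.le (h x hx hxδ).2⟩
end

section
/- Let Y ⊆ ℝ^p be nonempty and compact, X ⊆ ℝ^d, and let S : X ⇉ Y be a set-valued map with nonempty values such that 0 ∈ S(x) for all x ∈ X and S is upper semicontinuous at x̄ ∈ X. Set L = span(S(x̄)) and define R(x) = { y_r ∈ L^⊥ : (L + y_r) ∩ S(x) ≠ ∅ }. Then Lim_{x→x̄} R(x) = {0}; that is, 0 ∈ R(x) for all x ∈ X, and for every sequence x_n → x̄ in X and every convergent sequence y_n ∈ R(x_n), one has lim y_n = 0. -/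
open MeasureTheory Filter Topology Set Pointwise
open scoped ENNReal

/-- let `S : X ⇉ Y` (`Y` compact) have nonempty values with `0 ∈ S(x)`
for all `x`, and be upper semicontinuous at `xb ∈ X`. With `L = span(S(xb))` and
`R(x) = { y_r ∈ L^⊥ : (L + y_r) ∩ S(x) ≠ ∅ }`, one has `Lim_{x→xb} R(x) = {0}`:
`0 ∈ R(x)` for every `x ∈ X`, and every convergent sequence `y_n ∈ R(x_n)` with
`x_n → xb` in `X` has limit `0`. -/
theorem stmt_17 {d p : ℕ}
    (X : Set (EuclideanSpace ℝ (Fin d))) (Y : Set (EuclideanSpace ℝ (Fin p)))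
    (hYne : Y.Nonempty) (hYcomp : IsCompact Y)
    (S : EuclideanSpace ℝ (Fin d) → Set (EuclideanSpace ℝ (Fin p)))
    (hSY : ∀ x ∈ X, S x ⊆ Y)
    (hSne : ∀ x ∈ X, (S x).Nonempty)
    (hS0 : ∀ x ∈ X, (0 : EuclideanSpace ℝ (Fin p)) ∈ S x)
    (xb : EuclideanSpace ℝ (Fin d)) (hxb : xb ∈ X)
    -- upper semicontinuity of `S` at `xb` (open-set formulation)
    (husc : ∀ U : Set (EuclideanSpace ℝ (Fin p)), IsOpen U → S xb ⊆ U →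
      ∃ δ > (0 : ℝ), ∀ x ∈ X, ‖x - xb‖ < δ → S x ⊆ U)
    (L : Submodule ℝ (EuclideanSpace ℝ (Fin p)))
    (hLdef : L = Submodule.span ℝ (S xb))
    (R : EuclideanSpace ℝ (Fin d) → Set (EuclideanSpace ℝ (Fin p)))
    (hRdef : ∀ x, R x = {yr | yr ∈ (Lᗮ : Set (EuclideanSpace ℝ (Fin p))) ∧
      (((fun z => z + yr) '' (L : Set (EuclideanSpace ℝ (Fin p)))) ∩ S x).Nonempty}) :
    (∀ x ∈ X, (0 : EuclideanSpace ℝ (Fin p)) ∈ R x) ∧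
    (∀ (xn : ℕ → EuclideanSpace ℝ (Fin d)) (yn : ℕ → EuclideanSpace ℝ (Fin p))
        (y : EuclideanSpace ℝ (Fin p)),
      (∀ n, xn n ∈ X) → Tendsto xn atTop (𝓝 xb) → (∀ n, yn n ∈ R (xn n)) →
        Tendsto yn atTop (𝓝 y) → y = 0) := by
  subst hLdef
  refine ⟨fun x hx => ?_, fun xn yn y hxn hx hyn hy => ?_⟩
  · rw [hRdef]
    exact ⟨Submodule.zero_mem _, 0, ⟨0, Submodule.zero_mem _, add_zero _⟩, hS0 x hx⟩
  · refine tendsto_nhds_unique hy (Metric.tendsto_atTop.2 fun ε hε => ?_)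
    obtain ⟨δ, hδ, hU⟩ := husc {v | ‖(Submodule.span ℝ (S xb))ᗮ.starProjection v‖ < ε}
      (isOpen_lt (by fun_prop) continuous_const) (fun v hv => by
        have hproj : (Submodule.span ℝ (S xb))ᗮ.starProjection v = 0 :=
          (Submodule.starProjection_apply_eq_zero_iff _).2
            (Submodule.le_orthogonal_orthogonal _ (Submodule.subset_span hv))
        rwa [mem_ofPred_eq, hproj, norm_zero])
    obtain ⟨N, hN⟩ := Metric.tendsto_atTop.1 hx δ hδ
    refine ⟨N, fun n hn => ?_⟩
    have hR := hyn n
    rw [hRdef] at hR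
    obtain ⟨horth, _, ⟨z, hz, rfl⟩, hzS⟩ := hR
    have hlt := hU (xn n) (hxn n) (by simpa [dist_eq_norm] using hN n hn) hzS
    have hprojz : (Submodule.span ℝ (S xb))ᗮ.starProjection z = 0 :=
      (Submodule.starProjection_apply_eq_zero_iff _).2
        (Submodule.le_orthogonal_orthogonal _ hz)
    have hprojy : (Submodule.span ℝ (S xb))ᗮ.starProjection (yn n) = yn n :=
      Submodule.starProjection_eq_self_iff.2 horth
    rw [mem_ofPred_eq, map_add, hprojz, hprojy, zero_add] at hlt
    simpa using hlt
end
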